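/- arXiv:1603.07365 — 4 statements merged into one kernel-verified Lean document; each statement's English description precedes it below -/
import Mathlib

section
/- Let p be real, let X be a real-valued random variable and Y a complex-valued random variable on the same probability space with E[|Y|·|X|^p] < ∞ (and, if p < 0, additionally Y = 0 almost surely on the event {X = 0}). Let g ∈ 𝒢_p satisfy E[|Y| ∫_ε^T |g(tX)| dt] < ∞ for all 0 < ε < T < ∞. Then the limit lim_{ε↓0, T↑∞} ∫_ε^T E[Y·g(tX)]/t^{p+1} dt exists and equals c_p^+(g)·E[Y·X_+^p] + c_p^-(g)·E[Y·X_-^p]. -/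
open MeasureTheory Filter Set Topology

/-- `x₊ᵖ`: equals `x^p` if `x > 0` and `0` otherwise (convention `0^0 = 0`). -/
noncomputable def posPow (x p : ℝ) : ℝ := if 0 < x then x ^ p else 0

theorem exists_norm_intervalIntegral_le_of_tendsto {f : ℝ → ℂ} {c : ℂ}
    (hf : ∀ a b : ℝ, 0 < a → 0 < b → IntervalIntegrable f volume a b)
    (hc : Tendsto (fun q : ℝ × ℝ => ∫ t in q.1..q.2, f t)
      ((𝓝[>] (0:ℝ)) ×ˢ atTop) (𝓝 c)) :
    ∃ C : ℝ, ∀ a b : ℝ, 0 < a → 0 < b → ‖∫ t in a..b, f t‖ ≤ C := by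
  have hev := hc.norm.eventually_le_const (lt_add_one ‖c‖)
  obtain ⟨P, hP, Q, hQ, hPQ⟩ := eventually_prod_iff.1 hev
  obtain ⟨δ, hδ, hδP⟩ := (eventually_nhdsWithin_iff.1 hP |> Metric.eventually_nhds_iff.1)
  obtain ⟨M, hM⟩ := eventually_atTop.1 hQ
  have hP' : ∀ a, 0 < a → a < δ → P a := fun a ha had =>
    hδP (by simpa [abs_of_pos ha] using had) ha
  set K := ‖c‖ + 1
  have hK : 0 ≤ K := by positivity
  set T := max M δ
  have hT : 0 < T := hδ.trans_le (le_max_right _ _)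
  set D := ∫ t in (δ / 2)..T, ‖f t‖
  have hδ2 : 0 < δ / 2 := by positivity
  have hδT : δ / 2 ≤ T := (half_le_self hδ.le).trans (le_max_right _ _)
  have hD : 0 ≤ D := intervalIntegral.integral_nonneg hδT fun _ _ => norm_nonneg _
  have key : ∀ a, 0 < a → ‖∫ t in a..T, f t‖ ≤ 2 * K + D := by
    intro a ha
    rcases lt_or_ge a δ with h | h
    · have := hPQ (hP' a ha h) (hM T (le_max_left _ _))
      simp only at this
      linarith
    rcases le_or_gt T a with h' | h'
    · have h1 := hPQ (hP' _ hδ2 (half_lt_self hδ)) (hM T (le_max_left _ _))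
      have h2 := hPQ (hP' _ hδ2 (half_lt_self hδ)) (hM a ((le_max_left _ _).trans h'))
      simp only at h1 h2
      rw [← intervalIntegral.integral_interval_sub_left (hf _ _ hδ2 hT) (hf _ _ hδ2 ha)]
      linarith [norm_sub_le (∫ t in (δ / 2)..T, f t) (∫ t in (δ / 2)..a, f t)]
    · have h1 : ‖∫ t in a..T, f t‖ ≤ ∫ t in a..T, ‖f t‖ :=
        intervalIntegral.norm_integral_le_integral_norm h'.le
      have h2 : (∫ t in a..T, ‖f t‖) ≤ D :=
        intervalIntegral.integral_mono_interval (by linarith) h'.le le_rfl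
          (Eventually.of_forall fun _ => norm_nonneg _) (hf _ _ hδ2 hT).norm
      linarith
  refine ⟨2 * (2 * K + D), fun a b ha hb => ?_⟩
  have h := intervalIntegral.integral_add_adjacent_intervals (hf a T ha hT) (hf T b hT hb)
  rw [intervalIntegral.integral_symm b T] at h
  rw [← h]
  have := norm_add_le (∫ t in a..T, f t) (-∫ t in b..T, f t)
  rw [norm_neg] at this
  linarith [key a ha, key b hb]

theorem intervalIntegrable_div_rpow {g : ℝ → ℂ} {a b : ℝ}
    (hg : IntervalIntegrable g volume a b) (ha : 0 < a) (hb : 0 < b) (p : ℝ) :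
    IntervalIntegrable (fun t => g t / ((t ^ p : ℝ) : ℂ)) volume a b := by
  simp only [div_eq_mul_inv]
  refine hg.mul_continuousOn fun t ht => ContinuousAt.continuousWithinAt ?_
  have ht0 : 0 < t := (lt_min ha hb).trans_le ht.1
  refine ContinuousAt.inv₀ ?_ (by exact_mod_cast (Real.rpow_pos_of_pos ht0 p).ne')
  exact Complex.continuous_ofReal.continuousAt.comp
    (Real.continuousAt_rpow_const _ _ (Or.inl ht0.ne'))

theorem integral_comp_mul_div_rpow_of_pos (g : ℝ → ℂ) (p : ℝ) {x a b : ℝ} (hx : 0 < x)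
    (ha : 0 < a) (hb : 0 < b) :
    ∫ t in a..b, g (t * x) / ((t ^ (p + 1) : ℝ) : ℂ)
      = ((x ^ p : ℝ) : ℂ) * ∫ s in (a * x)..(b * x), g s / ((s ^ (p + 1) : ℝ) : ℂ) := by
  have h := intervalIntegral.integral_comp_mul_right (a := a) (b := b)
    (fun s => g s / ((s ^ (p + 1) : ℝ) : ℂ)) hx.ne'
  have hxc : (x : ℂ) ≠ 0 := by exact_mod_cast hx.ne'
  have hxp : ((x ^ p : ℝ) : ℂ) ≠ 0 := by exact_mod_cast (Real.rpow_pos_of_pos hx p).ne'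
  have h' : ∫ s in (a * x)..(b * x), g s / ((s ^ (p + 1) : ℝ) : ℂ)
      = x * ∫ t in a..b, g (t * x) / (((t * x) ^ (p + 1) : ℝ) : ℂ) := by
    rw [h, Complex.real_smul, Complex.ofReal_inv, mul_inv_cancel_left₀ hxc]
  rw [h', ← intervalIntegral.integral_const_mul, ← intervalIntegral.integral_const_mul]
  refine intervalIntegral.integral_congr fun t ht => ?_
  have ht0 : 0 < t := (lt_min ha hb).trans_le ht.1
  have htp : ((t ^ (p + 1) : ℝ) : ℂ) ≠ 0 := by
    exact_mod_cast (Real.rpow_pos_of_pos ht0 _).ne'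
  rw [Real.mul_rpow ht0.le hx.le, Real.rpow_add_one hx.ne']
  push_cast
  field_simp

theorem integral_comp_mul_div_rpow {g : ℝ → ℂ} (hg0 : g 0 = 0) (p x : ℝ) {a b : ℝ}
    (ha : 0 < a) (hb : 0 < b) :
    ∫ t in a..b, g (t * x) / ((t ^ (p + 1) : ℝ) : ℂ)
      = (posPow x p : ℂ) * (∫ s in (a * |x|)..(b * |x|), g s / ((s ^ (p + 1) : ℝ) : ℂ))
        + (posPow (-x) p : ℂ)
          * ∫ s in (a * |x|)..(b * |x|), g (-s) / ((s ^ (p + 1) : ℝ) : ℂ) := by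
  rcases lt_trichotomy x 0 with hx | rfl | hx
  · have h := integral_comp_mul_div_rpow_of_pos (fun s => g (-s)) p (neg_pos.2 hx) ha hb
    simp only [mul_neg, neg_neg] at h
    simp [posPow, hx, not_lt.2 hx.le, abs_of_neg hx, h]
  · simp [posPow, hg0]
  · simp [posPow, hx, not_lt.2 hx.le, abs_of_pos hx,
      integral_comp_mul_div_rpow_of_pos g p hx ha hb]

theorem abs_posPow_le (x p : ℝ) : |posPow x p| ≤ |x| ^ p := by
  unfold posPow
  split_ifs with h
  · rw [abs_of_pos h, abs_of_pos (Real.rpow_pos_of_pos h p)]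
  · simpa using Real.rpow_nonneg (abs_nonneg x) p

theorem measurable_posPow (p : ℝ) : Measurable fun x => posPow x p := by
  unfold posPow
  exact Measurable.ite measurableSet_Ioi (by fun_prop) measurable_const

theorem integrable_mul_posPow {Ω : Type*} [MeasurableSpace Ω] {μ : Measure Ω} {p : ℝ}
    {X : Ω → ℝ} {Y : Ω → ℂ} (hX : Measurable X) (hY : AEStronglyMeasurable Y μ)
    (hmom : Integrable (fun ω => ‖Y ω‖ * |X ω| ^ p) μ) :
    Integrable (fun ω => Y ω * (posPow (X ω) p : ℂ)) μ := by
  refine hmom.mono' (hY.mul (Complex.measurable_ofReal.comp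
    ((measurable_posPow p).comp hX)).aestronglyMeasurable) (Eventually.of_forall fun ω => ?_)
  rw [norm_mul, Complex.norm_real, Real.norm_eq_abs]
  gcongr
  exact abs_posPow_le _ _

theorem tendsto_mul_prodMk_nhdsGT_atTop {r : ℝ} (hr : 0 < r) :
    Tendsto (fun q : ℝ × ℝ => (q.1 * r, q.2 * r)) ((𝓝[>] (0:ℝ)) ×ˢ atTop)
      ((𝓝[>] (0:ℝ)) ×ˢ atTop) := by
  refine Tendsto.prodMap (f := fun t : ℝ => t * r) (g := fun t : ℝ => t * r) ?_
    (tendsto_id.atTop_mul_const hr)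
  refine tendsto_nhdsWithin_iff.2 ⟨?_, ?_⟩
  · simpa using (tendsto_id.mul_const r : Tendsto (fun t : ℝ => t * r) (𝓝 0) _).mono_left
      (nhdsWithin_le_nhds (s := Ioi 0))
  · filter_upwards [self_mem_nhdsWithin] with t ht using mul_pos ht hr

theorem tendsto_integral_comp_mul_div_rpow {g : ℝ → ℂ} {cplus cminus : ℂ} (hg0 : g 0 = 0)
    (p x : ℝ)
    (hcp : Tendsto (fun q : ℝ × ℝ => ∫ t in q.1..q.2, g t / ((t ^ (p + 1) : ℝ) : ℂ))
      ((𝓝[>] (0:ℝ)) ×ˢ atTop) (𝓝 cplus))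
    (hcm : Tendsto (fun q : ℝ × ℝ => ∫ t in q.1..q.2, g (-t) / ((t ^ (p + 1) : ℝ) : ℂ))
      ((𝓝[>] (0:ℝ)) ×ˢ atTop) (𝓝 cminus)) :
    Tendsto (fun q : ℝ × ℝ => ∫ t in q.1..q.2, g (t * x) / ((t ^ (p + 1) : ℝ) : ℂ))
      ((𝓝[>] (0:ℝ)) ×ˢ atTop)
      (𝓝 ((posPow x p : ℂ) * cplus + (posPow (-x) p : ℂ) * cminus)) := by
  rcases eq_or_ne x 0 with rfl | hx
  · simp [posPow, hg0]
  have hq := tendsto_mul_prodMk_nhdsGT_atTop (abs_pos.2 hx)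
  refine Tendsto.congr' ?_ (((hcp.comp hq).const_mul (posPow x p : ℂ)).add
    ((hcm.comp hq).const_mul (posPow (-x) p : ℂ)))
  filter_upwards [prod_mem_prod (self_mem_nhdsWithin (a := (0:ℝ)) (s := Ioi 0))
    (Ioi_mem_atTop (0:ℝ))] with q hq
  exact (integral_comp_mul_div_rpow hg0 p x hq.1 hq.2).symm

theorem integrable_prod_mul_comp_mul_div_rpow {Ω : Type*} [MeasurableSpace Ω] {μ : Measure Ω}
    [SFinite μ] {X : Ω → ℝ} {Y : Ω → ℂ} (hX : Measurable X) (hY : AEStronglyMeasurable Y μ)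
    {g : ℝ → ℂ} (hloc : LocallyIntegrable g volume) (hmeas : Measurable g) (hg0 : g 0 = 0)
    {a b : ℝ} (ha : 0 < a) (hab : a < b) (p : ℝ)
    (hint : Integrable (fun ω => ‖Y ω‖ * ∫ t in a..b, ‖g (t * X ω)‖) μ) :
    Integrable (fun z : Ω × ℝ => Y z.1 * g (z.2 * X z.1) / ((z.2 ^ p : ℝ) : ℂ))
      (μ.prod (volume.restrict (Ioc a b))) := by
  have hY' : AEStronglyMeasurable (fun z : Ω × ℝ => Y z.1)
      (μ.prod (volume.restrict (Ioc a b))) := hY.comp_fst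
  have hgX : AEStronglyMeasurable (fun z : Ω × ℝ => g (z.2 * X z.1))
      (μ.prod (volume.restrict (Ioc a b))) :=
    (hmeas.comp (measurable_snd.mul (hX.comp measurable_fst))).aestronglyMeasurable
  have hprod : Integrable (fun z : Ω × ℝ => Y z.1 * g (z.2 * X z.1))
      (μ.prod (volume.restrict (Ioc a b))) := by
    refine (integrable_prod_iff (hY'.mul hgX)).2 ⟨Eventually.of_forall fun ω => ?_, ?_⟩
    · refine Integrable.const_mul ?_ (Y ω)
      rcases eq_or_ne (X ω) 0 with h | h
      · simp [h, hg0]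
      have := ((hloc.integrableOn_isCompact isCompact_uIcc).intervalIntegrable
        (a := a * X ω) (b := b * X ω)).comp_mul_right (c := X ω)
      rw [mul_div_cancel_right₀ _ h, mul_div_cancel_right₀ _ h] at this
      exact (intervalIntegrable_iff_integrableOn_Ioc_of_le hab.le).1 this
    · simpa only [Pi.mul_apply, norm_mul, integral_const_mul, intervalIntegral.integral_of_le hab.le]
        using hint
  obtain ⟨C, hC⟩ : ∃ C : ℝ, ∀ t ∈ Icc a b, ‖(((t ^ p : ℝ) : ℂ))⁻¹‖ ≤ C := by
    refine isCompact_Icc.exists_bound_of_continuousOn fun t ht =>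
      ContinuousAt.continuousWithinAt ?_
    have ht0 : 0 < t := ha.trans_le ht.1
    refine ContinuousAt.inv₀ ?_ (by exact_mod_cast (Real.rpow_pos_of_pos ht0 p).ne')
    exact Complex.continuous_ofReal.continuousAt.comp
      (Real.continuousAt_rpow_const _ _ (Or.inl ht0.ne'))
  simp only [div_eq_mul_inv]
  refine hprod.mul_bdd (c := C) (Measurable.aestronglyMeasurable (by fun_prop)) ?_
  have : ∀ᵐ t ∂(volume.restrict (Ioc a b)), ‖(((t ^ p : ℝ) : ℂ))⁻¹‖ ≤ C := by
    filter_upwards [ae_restrict_mem measurableSet_Ioc] with t ht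
    exact hC t (Ioc_subset_Icc_self ht)
  exact Measure.quasiMeasurePreserving_snd.ae this

theorem stmt1 {Ω : Type*} [MeasurableSpace Ω] (μ : Measure Ω) [IsProbabilityMeasure μ]
    (p : ℝ) (X : Ω → ℝ) (Y : Ω → ℂ)
    (hX : Measurable X) (hY : AEStronglyMeasurable Y μ)
    (hmom : Integrable (fun ω => ‖Y ω‖ * |X ω| ^ p) μ)
    (hneg : p < 0 → ∀ᵐ ω ∂μ, X ω = 0 → Y ω = 0)
    (g : ℝ → ℂ) (cplus cminus : ℂ)
    (hloc : LocallyIntegrable g volume) (hmeas : Measurable g) (hg0 : g 0 = 0)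
    (hcp : Tendsto (fun q : ℝ × ℝ => ∫ t in q.1..q.2, g t / ((t ^ (p + 1) : ℝ) : ℂ))
      ((𝓝[>] (0:ℝ)) ×ˢ atTop) (𝓝 cplus))
    (hcm : Tendsto (fun q : ℝ × ℝ => ∫ t in q.1..q.2, g (-t) / ((t ^ (p + 1) : ℝ) : ℂ))
      ((𝓝[>] (0:ℝ)) ×ˢ atTop) (𝓝 cminus))
    (hint : ∀ ε T : ℝ, 0 < ε → ε < T →
      Integrable (fun ω => ‖Y ω‖ * ∫ t in ε..T, ‖g (t * X ω)‖) μ) :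
    Tendsto
      (fun q : ℝ × ℝ =>
        ∫ t in q.1..q.2, (∫ ω, Y ω * g (t * X ω) ∂μ) / ((t ^ (p + 1) : ℝ) : ℂ))
      ((𝓝[>] (0:ℝ)) ×ˢ atTop)
      (𝓝 (cplus * ∫ ω, Y ω * (posPow (X ω) p : ℂ) ∂μ
          + cminus * ∫ ω, Y ω * (posPow (-(X ω)) p : ℂ) ∂μ)) := by
  have hgi : ∀ a b : ℝ, IntervalIntegrable g volume a b := fun a b =>
    (hloc.integrableOn_isCompact isCompact_uIcc).intervalIntegrable
  have hgi' : ∀ a b : ℝ, IntervalIntegrable (fun t => g (-t)) volume a b := fun a b => by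
    simpa using (hgi (-a) (-b)).comp_mul_left (c := -1)
  obtain ⟨C, hC⟩ := exists_norm_intervalIntegral_le_of_tendsto
    (fun a b ha hb => intervalIntegrable_div_rpow (hgi a b) ha hb (p + 1)) hcp
  obtain ⟨D, hD⟩ := exists_norm_intervalIntegral_le_of_tendsto
    (fun a b ha hb => intervalIntegrable_div_rpow (hgi' a b) ha hb (p + 1)) hcm
  have hC0 : 0 ≤ C := (norm_nonneg _).trans (hC 1 1 one_pos one_pos)
  have hD0 : 0 ≤ D := (norm_nonneg _).trans (hD 1 1 one_pos one_pos)
  have hev : ∀ᶠ q : ℝ × ℝ in (𝓝[>] (0:ℝ)) ×ˢ atTop, 0 < q.1 ∧ q.1 < q.2 := by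
    filter_upwards [prod_mem_prod (Ioo_mem_nhdsGT (zero_lt_one' ℝ)) (Ioi_mem_atTop (1:ℝ))]
      with q hq using ⟨hq.1.1, hq.1.2.trans hq.2⟩
  have hpair : ∀ q : ℝ × ℝ, 0 < q.1 ∧ q.1 < q.2 →
      Integrable (fun z : Ω × ℝ => Y z.1 * g (z.2 * X z.1) / ((z.2 ^ (p + 1) : ℝ) : ℂ))
        (μ.prod (volume.restrict (Ioc q.1 q.2))) := fun q hq =>
    integrable_prod_mul_comp_mul_div_rpow hX hY hloc hmeas hg0 hq.1 hq.2 (p + 1)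
      (hint _ _ hq.1 hq.2)
  have hinner : ∀ q : ℝ × ℝ, 0 < q.1 ∧ q.1 < q.2 → ∀ ω,
      ∫ t in Ioc q.1 q.2, Y ω * g (t * X ω) / ((t ^ (p + 1) : ℝ) : ℂ)
        = Y ω * ∫ t in q.1..q.2, g (t * X ω) / ((t ^ (p + 1) : ℝ) : ℂ) := by
    intro q hq ω
    rw [intervalIntegral.integral_of_le hq.2.le, ← integral_const_mul]
    simp only [mul_div_assoc]
  have hlim : Tendsto (fun q : ℝ × ℝ =>
        ∫ ω, Y ω * (∫ t in q.1..q.2, g (t * X ω) / ((t ^ (p + 1) : ℝ) : ℂ)) ∂μ)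
      ((𝓝[>] (0:ℝ)) ×ˢ atTop)
      (𝓝 (∫ ω, Y ω * ((posPow (X ω) p : ℂ) * cplus
        + (posPow (-(X ω)) p : ℂ) * cminus) ∂μ)) := by
    refine tendsto_integral_filter_of_dominated_convergence
      (fun ω => (‖Y ω‖ * |X ω| ^ p) * (C + D)) ?_ ?_ (hmom.mul_const _)
      (Eventually.of_forall fun ω =>
        (tendsto_integral_comp_mul_div_rpow hg0 p (X ω) hcp hcm).const_mul (Y ω))
    · filter_upwards [hev] with q hq
      exact (hpair q hq).integral_prod_left.aestronglyMeasurable.congr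
        (Eventually.of_forall (hinner q hq))
    · filter_upwards [hev] with q hq
      refine Eventually.of_forall fun ω => ?_
      rw [norm_mul, mul_assoc]
      refine mul_le_mul_of_nonneg_left ?_ (norm_nonneg _)
      rcases eq_or_ne (X ω) 0 with h | h
      · simp only [h, mul_zero, hg0, zero_div, intervalIntegral.integral_zero, norm_zero]
        positivity
      have hb : 0 < q.2 := hq.1.trans hq.2
      have hx := abs_pos.2 h
      rw [integral_comp_mul_div_rpow hg0 p (X ω) hq.1 hb, mul_add]
      refine (norm_add_le _ _).trans (add_le_add ?_ ?_) <;>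
        rw [norm_mul, Complex.norm_real, Real.norm_eq_abs]
      · exact mul_le_mul (abs_posPow_le _ _) (hC _ _ (mul_pos hq.1 hx) (mul_pos hb hx))
          (norm_nonneg _) (by positivity)
      · refine mul_le_mul ?_ (hD _ _ (mul_pos hq.1 hx) (mul_pos hb hx))
          (norm_nonneg _) (by positivity)
        simpa using abs_posPow_le (-(X ω)) p
  have hvalue : ∫ ω, Y ω * ((posPow (X ω) p : ℂ) * cplus
        + (posPow (-(X ω)) p : ℂ) * cminus) ∂μ
      = cplus * ∫ ω, Y ω * (posPow (X ω) p : ℂ) ∂μ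
        + cminus * ∫ ω, Y ω * (posPow (-(X ω)) p : ℂ) ∂μ := by
    rw [← integral_const_mul, ← integral_const_mul, ← integral_add]
    · congr 1 with ω
      ring
    · exact (integrable_mul_posPow hX hY hmom).const_mul _
    · exact (integrable_mul_posPow hX.neg hY (by simpa using hmom)).const_mul _
  rw [← hvalue]
  refine hlim.congr' ?_
  filter_upwards [hev] with q hq
  calc ∫ ω, Y ω * (∫ t in q.1..q.2, g (t * X ω) / ((t ^ (p + 1) : ℝ) : ℂ)) ∂μ
      = ∫ ω, (∫ t in Ioc q.1 q.2, Y ω * g (t * X ω) / ((t ^ (p + 1) : ℝ) : ℂ)) ∂μ := by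
        simp only [hinner q hq]
    _ = ∫ t in Ioc q.1 q.2, ∫ ω, Y ω * g (t * X ω) / ((t ^ (p + 1) : ℝ) : ℂ) ∂μ :=
        integral_integral_swap (hpair q hq)
    _ = ∫ t in q.1..q.2, (∫ ω, Y ω * g (t * X ω) ∂μ) / ((t ^ (p + 1) : ℝ) : ℂ) := by
        rw [intervalIntegral.integral_of_le hq.2.le]
        simp only [integral_div]
end

section
/- Let p ∈ (0,∞), r ∈ ℝ, u ∈ ℝ, and let X be a real random variable with E|X|^r + E|X|^{r+p} < ∞ (and P(X = 0) = 0 if r < 0 or r + p < 0). Set ℓ := ⌈p−1⌉ and, for real s with E|X|^s < ∞, set F_s(w) := i^s · E[conj(X^s)·e^{iwX}] (the fractional derivative of order s of the characteristic function of X). Define the Taylor-type remainder R(u;δ) := F_r(u+δ) − Σ_{j=0}^{ℓ} F_{r+j}(u)·δ^j/j!. Then the function t ↦ R(u;t)/(it)^{p+1} + R(u;−t)/(−it)^{p+1} is Lebesgue integrable on (0,∞) and E[X_+^{r+p}·e^{iuX}] = ( F_{p+r}(u)/(2·i^{p+r}) )·𝟙{p ∈ ℕ} + ( Γ(p+1)/(2π·i^r)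 ) · ∫_0^∞ ( R(u;t)/(it)^{p+1} + R(u;−t)/(−it)^{p+1} ) dt. -/
open MeasureTheory Filter Set Topology
open scoped Classical

/-- Principal complex power of a real number, with the convention `0 ^ s = 0`. -/
noncomputable def rcpow (x s : ℝ) : ℂ := if x = 0 then 0 else (x : ℂ) ^ (s : ℂ)

/-- `F s w = iˢ · E[conj(Xˢ)·e^{iwX}]`, the fractional derivative of order `s` of the
characteristic function of `X`, evaluated at `w`. -/
noncomputable def fracDeriv {Ω : Type*} [MeasurableSpace Ω] (μ : Measure Ω) (X : Ω → ℝ)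
    (s w : ℝ) : ℂ :=
  Complex.I ^ (s : ℂ) *
    ∫ ω, (starRingEnd ℂ) (rcpow (X ω) s) * Complex.exp (Complex.I * w * X ω) ∂μ

/-- A function bounded by `C t ^ a` and by `C t ^ b` with `a < p < b` is integrable against
`t ^ (-p - 1)` on `(0, ∞)`. -/
lemma integrableOn_rpow_smul_of_norm_le {E : Type*} [NormedAddCommGroup E] [NormedSpace ℝ E]
    {h : ℝ → E} {a b p C : ℝ} (hc : ContinuousOn h (Ioi 0)) (hap : a < p) (hpb : p < b)
    (ha : ∀ t, 0 < t → ‖h t‖ ≤ C * t ^ a) (hb : ∀ t, 0 < t → ‖h t‖ ≤ C * t ^ b) :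
    IntegrableOn (fun t : ℝ => t ^ (-p - 1) • h t) (Ioi 0) := by
  have hc' : ContinuousOn (fun t : ℝ => t ^ (-p - 1) • h t) (Ioi 0) :=
    (continuousOn_id.rpow_const fun t ht => Or.inl (ne_of_gt ht)).smul hc
  rw [← Ioc_union_Ioi_eq_Ioi zero_le_one]
  refine IntegrableOn.union ?_ ?_
  · have hI : IntegrableOn (fun t : ℝ => C * t ^ (b - p - 1)) (Ioc 0 1) := by
      rw [integrableOn_Ioc_iff_integrableOn_Ioo]
      exact ((intervalIntegral.integrableOn_Ioo_rpow_iff zero_lt_one).2 (by linarith)).const_mul C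
    refine hI.mono' ((hc'.mono Ioc_subset_Ioi_self).aestronglyMeasurable measurableSet_Ioc) ?_
    filter_upwards [ae_restrict_mem measurableSet_Ioc] with t ht
    have ht0 : 0 < t := ht.1
    rw [norm_smul, Real.norm_of_nonneg (Real.rpow_nonneg ht0.le _)]
    calc t ^ (-p - 1) * ‖h t‖ ≤ t ^ (-p - 1) * (C * t ^ b) := by gcongr; exact hb t ht0
      _ = C * t ^ (b - p - 1) := by
        rw [show b - p - 1 = (-p - 1) + b by ring, Real.rpow_add ht0]; ring
  · have hI : IntegrableOn (fun t : ℝ => C * t ^ (a - p - 1)) (Ioi 1) :=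
      (integrableOn_Ioi_rpow_of_lt (by linarith) zero_lt_one).const_mul C
    refine hI.mono' ((hc'.mono (Ioi_subset_Ioi zero_le_one)).aestronglyMeasurable
      measurableSet_Ioi) ?_
    filter_upwards [ae_restrict_mem measurableSet_Ioi] with t ht
    have ht0 : 0 < t := zero_lt_one.trans ht
    rw [norm_smul, Real.norm_of_nonneg (Real.rpow_nonneg ht0.le _)]
    calc t ^ (-p - 1) * ‖h t‖ ≤ t ^ (-p - 1) * (C * t ^ a) := by gcongr; exact ha t ht0
      _ = C * t ^ (a - p - 1) := by
        rw [show a - p - 1 = (-p - 1) + a by ring, Real.rpow_add ht0]; ring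

/-- Integration by parts against `t ^ (-p)` for functions whose growth makes the boundary terms
vanish. -/
lemma integral_Ioi_rpow_smul_deriv {h h' : ℝ → ℂ} {a b p C : ℝ} (hp : 0 < p)
    (hd : ∀ t, 0 < t → HasDerivAt h (h' t) t) (hap : a < p) (hpb : p < b)
    (ha : ∀ t, 0 < t → ‖h t‖ ≤ C * t ^ a) (hb : ∀ t, 0 < t → ‖h t‖ ≤ C * t ^ b)
    (hi : IntegrableOn (fun t : ℝ => t ^ (-p) • h' t) (Ioi 0)) :
    ∫ t in Ioi (0 : ℝ), t ^ (-p - 1) • h t = (1 / p) • ∫ t in Ioi (0 : ℝ), t ^ (-p) • h' t := by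
  have hih : IntegrableOn (fun t : ℝ => t ^ (-p - 1) • h t) (Ioi 0) :=
    integrableOn_rpow_smul_of_norm_le
      (fun t ht => (hd t ht).continuousAt.continuousWithinAt) hap hpb ha hb
  have hF (c : ℝ) (hc : ∀ t, 0 < t → ‖h t‖ ≤ C * t ^ c) (t : ℝ) (ht : 0 < t) :
      ‖t ^ (-p) • h t‖ ≤ C * t ^ (c - p) := by
    rw [norm_smul, Real.norm_of_nonneg (Real.rpow_nonneg ht.le _)]
    calc t ^ (-p) * ‖h t‖ ≤ t ^ (-p) * (C * t ^ c) := by gcongr; exact hc t ht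
      _ = C * t ^ (c - p) := by
        rw [show c - p = -p + c by ring, Real.rpow_add ht]; ring
  have h0 : (0 : ℝ) ^ (-p) • h 0 = 0 := by rw [Real.zero_rpow (by linarith), zero_smul]
  have hderiv : ∀ t ∈ Ioi (0 : ℝ), HasDerivAt (fun t : ℝ => t ^ (-p) • h t)
      (t ^ (-p) • h' t + ((-p) * t ^ (-p - 1)) • h t) t := fun t ht =>
    (Real.hasDerivAt_rpow_const (Or.inl (ne_of_gt ht))).smul (hd t ht)
  have hcont : ContinuousWithinAt (fun t : ℝ => t ^ (-p) • h t) (Ici 0) 0 := by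
    rw [← continuousWithinAt_Ioi_iff_Ici]
    unfold ContinuousWithinAt
    simp only [h0]
    refine squeeze_zero_norm' (a := fun t : ℝ => C * t ^ (b - p))
      (eventually_mem_nhdsWithin.mono fun t ht => hF b hb t ht) ?_
    have : Tendsto (fun t : ℝ => C * t ^ (b - p)) (𝓝 0) (𝓝 (C * 0 ^ (b - p))) :=
      ((Real.continuousAt_rpow_const 0 (b - p) (Or.inr (by linarith))).tendsto).const_mul C
    rw [Real.zero_rpow (by linarith), mul_zero] at this
    exact this.mono_left nhdsWithin_le_nhds
  have htop : Tendsto (fun t : ℝ => t ^ (-p) • h t) atTop (𝓝 0) := by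
    refine squeeze_zero_norm' (a := fun t : ℝ => C * t ^ (a - p))
      ((eventually_gt_atTop 0).mono fun t ht => hF a ha t ht) ?_
    simpa [neg_sub] using (tendsto_rpow_neg_atTop (y := p - a) (by linarith)).const_mul C
  have hih' : IntegrableOn (fun t : ℝ => ((-p) * t ^ (-p - 1)) • h t) (Ioi 0) := by
    simp_rw [mul_smul]
    exact hih.smul (-p)
  have key := integral_Ioi_of_hasDerivAt_of_tendsto hcont hderiv (hi.add hih') htop
  rw [h0, sub_zero, integral_add hi hih'] at key
  simp_rw [mul_smul] at key
  rw [integral_smul, neg_smul, ← sub_eq_add_neg, sub_eq_zero] at key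
  rw [key, smul_smul, one_div_mul_cancel hp.ne', one_smul]

/-- Fubini for the representation of `s ^ (-q)` as a Laplace transform. -/
lemma Gamma_mul_integral_mul_rpow_neg {q : ℝ} (hq : 0 < q) {h : ℝ → ℝ} (hm : Measurable h)
    (hh : IntegrableOn (fun s : ℝ => s ^ (-q) • h s) (Ioi 0)) :
    Real.Gamma q * ∫ s in Ioi (0 : ℝ), s ^ (-q) • h s
      = ∫ v in Ioi (0 : ℝ), v ^ (q - 1) * ∫ s in Ioi (0 : ℝ), h s * Real.exp (-(v * s)) := by
  have hG : ∀ s, 0 < s → ∫ v in Ioi (0 : ℝ), v ^ (q - 1) * Real.exp (-(v * s))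
      = s ^ (-q) * Real.Gamma q := fun s hs => by
    simp_rw [mul_comm _ s]
    rw [Real.integral_rpow_mul_exp_neg_mul_Ioi hq hs, one_div, Real.inv_rpow hs.le,
      Real.rpow_neg hs.le]
  have hGi : ∀ s, 0 < s → IntegrableOn (fun v : ℝ => v ^ (q - 1) * Real.exp (-(v * s))) (Ioi 0) :=
    fun s hs => not_imp_comm.1 integral_undef (by
      rw [hG s hs]; exact (mul_pos (Real.rpow_pos_of_pos hs _) (Real.Gamma_pos_of_pos hq)).ne')
  have hint : Integrable (Function.uncurry fun s v : ℝ =>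
      h s * (v ^ (q - 1) * Real.exp (-(v * s))))
      ((volume.restrict (Ioi 0)).prod (volume.restrict (Ioi 0))) := by
    refine (integrable_prod_iff (by fun_prop)).2 ⟨?_, ?_⟩
    · filter_upwards [ae_restrict_mem measurableSet_Ioi] with s hs
      exact (hGi s hs).const_mul (h s)
    · refine (hh.norm.mul_const (Real.Gamma q)).congr ?_
      filter_upwards [ae_restrict_mem measurableSet_Ioi] with s hs
      have : ∀ v ∈ Ioi (0 : ℝ), ‖h s * (v ^ (q - 1) * Real.exp (-(v * s)))‖
          = ‖h s‖ * (v ^ (q - 1) * Real.exp (-(v * s))) := fun v hv => by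
        rw [norm_mul, Real.norm_of_nonneg (r := v ^ (q - 1) * _)
          (mul_nonneg (Real.rpow_nonneg (le_of_lt hv) _) (Real.exp_nonneg _))]
      simp only [Function.uncurry]
      rw [setIntegral_congr_fun measurableSet_Ioi this, integral_const_mul, hG s hs, norm_smul,
        Real.norm_of_nonneg (Real.rpow_nonneg (le_of_lt hs) _)]
      ring
  have hswap := integral_integral_swap hint
  rw [← integral_const_mul]
  trans ∫ s in Ioi (0 : ℝ), ∫ v in Ioi (0 : ℝ), h s * (v ^ (q - 1) * Real.exp (-(v * s)))
  · refine setIntegral_congr_fun measurableSet_Ioi fun s hs => ?_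
    rw [integral_const_mul, hG s hs, smul_eq_mul]
    ring
  · rw [hswap]
    refine setIntegral_congr_fun measurableSet_Ioi fun v _ => ?_
    rw [← integral_const_mul]
    congr 1 with s
    ring

lemma integrableOn_rpow_div_one_add_sq {a : ℝ} (h0 : 0 < a) (h2 : a < 2) :
    IntegrableOn (fun v : ℝ => v ^ (a - 1) * (1 + v ^ 2)⁻¹) (Ioi 0) := by
  have := integrableOn_rpow_smul_of_norm_le (h := fun v : ℝ => (1 + v ^ 2)⁻¹) (a := -2) (b := 0)
    (p := -a) (C := 1) ?_ (by linarith) (by linarith) ?_ ?_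
  · simpa using this
  · exact Continuous.continuousOn
      (Continuous.inv₀ (by fun_prop) fun v => by positivity)
  · intro t ht
    rw [Real.norm_of_nonneg (by positivity), one_mul, Real.rpow_neg ht.le, Real.rpow_two]
    exact inv_anti₀ (by positivity) (by linarith)
  · intro t ht
    rw [Real.norm_of_nonneg (by positivity), one_mul, Real.rpow_zero]
    exact inv_le_one_of_one_le₀ (by nlinarith)

lemma integral_rpow_div_one_add_sq {a : ℝ} (h0 : 0 < a) (h2 : a < 2) :
    ∫ v in Ioi (0 : ℝ), v ^ (a - 1) * (1 + v ^ 2)⁻¹ = Real.pi / (2 * Real.sin (Real.pi * a / 2)) := by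
  have hE : ∫ s in Ioi (0 : ℝ), s ^ (-(a / 2)) • Real.exp (-s) = Real.Gamma (1 - a / 2) := by
    rw [Real.Gamma_eq_integral (by linarith)]
    congr 1 with s
    rw [smul_eq_mul, mul_comm, show 1 - a / 2 - 1 = -(a / 2) by ring]
  have hEi : IntegrableOn (fun s : ℝ => s ^ (-(a / 2)) • Real.exp (-s)) (Ioi 0) :=
    not_imp_comm.1 integral_undef (by
      rw [hE]; exact (Real.Gamma_pos_of_pos (by linarith)).ne')
  have key := Gamma_mul_integral_mul_rpow_neg (q := a / 2) (by linarith)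
    (h := fun s => Real.exp (-s)) (by fun_prop) hEi
  rw [hE, Real.Gamma_mul_Gamma_one_sub] at key
  have hL : ∀ v ∈ Ioi (0 : ℝ), v ^ (a / 2 - 1) * ∫ s in Ioi (0 : ℝ),
      Real.exp (-s) * Real.exp (-(v * s)) = v ^ (a / 2 - 1) * (1 + v)⁻¹ := fun v hv => by
    have hv0 : 0 < v := hv
    have : ∀ s : ℝ, Real.exp (-s) * Real.exp (-(v * s)) = Real.exp (-(1 + v) * s) := fun s => by
      rw [← Real.exp_add]; ring_nf
    simp_rw [this]
    rw [integral_exp_mul_Ioi (by linarith), mul_zero, Real.exp_zero, neg_div_neg_eq, one_div]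
  rw [setIntegral_congr_fun measurableSet_Ioi hL,
    ← integral_comp_rpow_Ioi_of_pos (p := 2) (by norm_num)] at key
  have hR : ∀ v ∈ Ioi (0 : ℝ), (2 * v ^ ((2 : ℝ) - 1)) • ((v ^ (2 : ℝ)) ^ (a / 2 - 1)
      * (1 + v ^ (2 : ℝ))⁻¹) = 2 * (v ^ (a - 1) * (1 + v ^ 2)⁻¹) := fun v hv => by
    have hv0 : 0 < v := hv
    rw [← Real.rpow_mul hv0.le, Real.rpow_two, smul_eq_mul,
      show a - 1 = ((2 : ℝ) - 1) + 2 * (a / 2 - 1) by ring, Real.rpow_add hv0]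
    ring
  rw [setIntegral_congr_fun measurableSet_Ioi hR, integral_const_mul] at key
  rw [show Real.pi * a / 2 = Real.pi * (a / 2) by ring, mul_comm (2 : ℝ), ← div_div, key]
  ring

/-- The Taylor remainder of order `n` of the complex exponential at `0`. -/
noncomputable def expRem (n : ℕ) (z : ℂ) : ℂ :=
  Complex.exp z - ∑ j ∈ Finset.range (n + 1), z ^ j / (Nat.factorial j)

lemma expRem_zero (z : ℂ) : expRem 0 z = Complex.exp z - 1 := by simp [expRem]

lemma expRem_succ (n : ℕ) (z : ℂ) :
    expRem (n + 1) z = expRem n z - z ^ (n + 1) / (Nat.factorial (n + 1)) := by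
  rw [expRem, Finset.sum_range_succ, expRem]
  ring

lemma expRem_apply_zero (n : ℕ) : expRem n 0 = 0 := by
  induction n with
  | zero => simp [expRem_zero]
  | succ n ih => simp [expRem_succ, ih]

lemma hasDerivAt_expRem_zero (z : ℂ) : HasDerivAt (expRem 0) (Complex.exp z) z := by
  rw [funext expRem_zero]
  exact (Complex.hasDerivAt_exp z).sub_const 1

lemma hasDerivAt_expRem_succ (n : ℕ) (z : ℂ) :
    HasDerivAt (expRem (n + 1)) (expRem n z) z := by
  have hpow (k : ℕ) : HasDerivAt (fun z : ℂ => z ^ (k + 1) / (Nat.factorial (k + 1)))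
      (z ^ k / (Nat.factorial k)) z := by
    refine ((hasDerivAt_pow (k + 1) z).div_const _).congr_deriv ?_
    rw [Nat.factorial_succ, add_tsub_cancel_right]
    push_cast
    exact mul_div_mul_left _ _ (Nat.cast_add_one_ne_zero k)
  induction n with
  | zero =>
    rw [funext (expRem_succ 0)]
    exact ((hasDerivAt_expRem_zero z).sub (hpow 0)).congr_deriv (by simp [expRem_zero])
  | succ n ih =>
    rw [funext (expRem_succ (n + 1))]
    exact (ih.sub (hpow (n + 1))).congr_deriv (expRem_succ n z).symm

lemma continuous_expRem (n : ℕ) : Continuous (expRem n) := by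
  unfold expRem
  fun_prop

lemma norm_expRem_I_mul_le (n : ℕ) (s : ℝ) : ‖expRem n (Complex.I * s)‖ ≤ |s| ^ (n + 1) := by
  induction n generalizing s with
  | zero =>
    rw [expRem_zero, zero_add, pow_one]
    exact Real.norm_exp_I_mul_ofReal_sub_one_le
  | succ n ih =>
    have hd : ∀ x ∈ uIcc 0 s, HasDerivWithinAt (fun x : ℝ => expRem (n + 1) (Complex.I * x))
        (expRem n (Complex.I * x) * Complex.I) (uIcc 0 s) x := fun x _ => by
      have h1 : HasDerivAt (fun x : ℝ => Complex.I * (x : ℂ)) Complex.I x := by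
        simpa using (Complex.ofRealCLM.hasDerivAt (x := x)).const_mul Complex.I
      exact ((hasDerivAt_expRem_succ n (Complex.I * x)).comp x h1).hasDerivWithinAt
    have hb : ∀ x ∈ uIcc 0 s, ‖expRem n (Complex.I * x) * Complex.I‖ ≤ |s| ^ (n + 1) :=
      fun x hx => by
        rw [norm_mul, Complex.norm_I, mul_one]
        refine (ih x).trans (pow_le_pow_left₀ (abs_nonneg x) ?_ _)
        simpa using abs_sub_left_of_mem_uIcc hx
    have := (convex_uIcc 0 s).norm_image_sub_le_of_norm_hasDerivWithin_le hd hb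
      left_mem_uIcc right_mem_uIcc
    simpa [expRem_apply_zero, ← pow_succ] using this

lemma norm_expRem_I_mul_le' (n : ℕ) (s : ℝ) : ‖expRem n (Complex.I * s)‖ ≤ 2 * |s| ^ n := by
  cases n with
  | zero =>
    rw [expRem_zero, mul_comm]
    refine (norm_sub_le _ _).trans ?_
    rw [Complex.norm_exp_ofReal_mul_I]
    norm_num
  | succ n =>
    rw [expRem_succ]
    refine (norm_sub_le _ _).trans ?_
    have h1 : ‖(Complex.I * s) ^ (n + 1) / (Nat.factorial (n + 1) : ℂ)‖ ≤ |s| ^ (n + 1) := by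
      rw [norm_div, norm_pow, norm_mul, Complex.norm_I, one_mul, Complex.norm_real,
        Complex.norm_natCast, Real.norm_eq_abs]
      exact div_le_self (by positivity) (by exact_mod_cast (n + 1).factorial_pos)
    linarith [norm_expRem_I_mul_le n s]

lemma I_cpow_ofReal (x : ℝ) :
    Complex.I ^ (x : ℂ) = Complex.exp ((Real.pi / 2 * x : ℝ) * Complex.I) := by
  rw [Complex.cpow_def_of_ne_zero Complex.I_ne_zero, Complex.log_I]
  push_cast
  ring_nf

lemma neg_I_cpow_ofReal (x : ℝ) :
    (-Complex.I) ^ (x : ℂ) = Complex.exp ((-(Real.pi / 2 * x) : ℝ) * Complex.I) := by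
  rw [Complex.cpow_def_of_ne_zero (neg_ne_zero.2 Complex.I_ne_zero), Complex.log_neg_I]
  push_cast
  ring_nf

/-- The symmetrised Taylor remainder of the exponential along the imaginary axis. -/
noncomputable def symmRem (p : ℝ) (n : ℕ) (s : ℝ) : ℂ :=
  expRem n (Complex.I * s) / Complex.I ^ ((p + 1 : ℝ) : ℂ)
    + expRem n (-(Complex.I * s)) / (-Complex.I) ^ ((p + 1 : ℝ) : ℂ)

lemma continuous_symmRem (p : ℝ) (n : ℕ) : Continuous (symmRem p n) := by
  have := continuous_expRem n
  unfold symmRem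
  fun_prop

lemma norm_symmRem_le_of_bound {p : ℝ} {n : ℕ} {s B : ℝ}
    (h₁ : ‖expRem n (Complex.I * s)‖ ≤ B) (h₂ : ‖expRem n (Complex.I * (-s : ℝ))‖ ≤ B) :
    ‖symmRem p n s‖ ≤ 2 * B := by
  rw [symmRem]
  refine (norm_add_le _ _).trans ?_
  rw [norm_div, norm_div, I_cpow_ofReal, neg_I_cpow_ofReal, Complex.norm_exp_ofReal_mul_I,
    Complex.norm_exp_ofReal_mul_I, div_one, div_one]
  rw [Complex.ofReal_neg, mul_neg] at h₂
  linarith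

lemma norm_symmRem_le (p : ℝ) (n : ℕ) (s : ℝ) : ‖symmRem p n s‖ ≤ 4 * |s| ^ (n : ℝ) := by
  refine (norm_symmRem_le_of_bound (norm_expRem_I_mul_le' n s)
    (abs_neg s ▸ norm_expRem_I_mul_le' n (-s))).trans_eq ?_
  rw [Real.rpow_natCast]
  ring

/-- For `p = n + 1` the terms of order `n + 1` cancel. -/
lemma symmRem_natCast_add_one (n : ℕ) (s : ℝ) :
    symmRem (n + 1) n s = symmRem (n + 1) (n + 1) s := by
  have h₁ : ((n + 1 + 1 : ℝ) : ℂ) = ((n + 2 : ℕ) : ℂ) := by push_cast; ring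
  rw [symmRem, symmRem, h₁, Complex.cpow_natCast, Complex.cpow_natCast, expRem_succ, expRem_succ]
  rw [neg_pow Complex.I, neg_pow (Complex.I * (s : ℂ))]
  have h₄ : Complex.I ^ (n + 2) ≠ 0 := pow_ne_zero _ Complex.I_ne_zero
  have h₆ : (-1 : ℂ) ^ (n + 2) = - (-1) ^ (n + 1) := by ring
  rw [h₆]
  field_simp
  ring

lemma exists_norm_symmRem_le {p : ℝ} {n : ℕ} (hpn : p ≤ n + 1) :
    ∃ b : ℝ, p < b ∧ ∀ s, ‖symmRem p n s‖ ≤ 4 * |s| ^ b := by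
  have key (m : ℕ) (s : ℝ) : ‖symmRem p m s‖ ≤ 4 * |s| ^ ((m + 1 : ℕ) : ℝ) := by
    refine (norm_symmRem_le_of_bound (norm_expRem_I_mul_le m s)
      (abs_neg s ▸ norm_expRem_I_mul_le m (-s))).trans ?_
    rw [Real.rpow_natCast]
    have : 0 ≤ |s| ^ (m + 1) := by positivity
    linarith
  rcases hpn.lt_or_eq with h | rfl
  · exact ⟨((n + 1 : ℕ) : ℝ), by exact_mod_cast h, key n⟩
  · refine ⟨((n + 1 + 1 : ℕ) : ℝ), by push_cast; linarith, fun s => ?_⟩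
    rw [symmRem_natCast_add_one]
    exact key (n + 1) s

lemma hasDerivAt_symmRem (p : ℝ) (n : ℕ) (s : ℝ) :
    HasDerivAt (symmRem (p + 1) (n + 1)) (symmRem p n s) s := by
  have h1 : HasDerivAt (fun x : ℝ => Complex.I * (x : ℂ)) Complex.I s := by
    simpa using (Complex.ofRealCLM.hasDerivAt (x := s)).const_mul Complex.I
  have hc (c : ℂ) (hc : c ≠ 0) : c ^ ((p + 1 + 1 : ℝ) : ℂ) = c ^ ((p + 1 : ℝ) : ℂ) * c := by
    rw [Complex.ofReal_add, Complex.cpow_add _ _ hc, Complex.ofReal_one, Complex.cpow_one]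
  have hI := Complex.I_ne_zero
  refine ((((hasDerivAt_expRem_succ n _).comp s h1).div_const _).add
    (((hasDerivAt_expRem_succ n _).comp s h1.neg).div_const _)).congr_deriv ?_
  rw [symmRem, Pi.neg_apply, hc _ hI, hc _ (neg_ne_zero.2 hI), mul_div_mul_right _ _ hI,
    mul_div_mul_right _ _ (neg_ne_zero.2 hI)]

lemma integrableOn_symmRem {p : ℝ} {n : ℕ} (hnp : n < p) (hpn : p ≤ n + 1) {σ : ℝ}
    (hσ : |σ| = 1) :
    IntegrableOn (fun t : ℝ => t ^ (-p - 1) • symmRem p n (σ * t)) (Ioi 0) := by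
  obtain ⟨b, hpb, hb⟩ := exists_norm_symmRem_le hpn
  have habs : ∀ t, 0 < t → |σ * t| = t := fun t ht => by rw [abs_mul, hσ, one_mul, abs_of_pos ht]
  refine integrableOn_rpow_smul_of_norm_le (a := n) (b := b) (C := 4)
    ((continuous_symmRem p n).comp (continuous_const_mul σ)).continuousOn hnp hpb
    (fun t ht => ?_) (fun t ht => ?_)
  · simpa [habs t ht] using norm_symmRem_le p n (σ * t)
  · simpa [habs t ht] using hb (σ * t)

/-- The Mellin-type integral of the symmetrised remainder along the ray of direction `σ`. -/
noncomputable def symmRemInt (p : ℝ) (n : ℕ) (σ : ℝ) : ℂ :=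
  ∫ t in Ioi (0 : ℝ), t ^ (-p - 1) • symmRem p n (σ * t)

lemma symmRemInt_succ {p : ℝ} {n : ℕ} (hnp : n < p) (hpn : p ≤ n + 1) {σ : ℝ} (hσ : |σ| = 1) :
    symmRemInt (p + 1) (n + 1) σ = (σ / (p + 1) : ℝ) * symmRemInt p n σ := by
  have hp : 0 < p := (Nat.cast_nonneg n).trans_lt hnp
  obtain ⟨b, hpb, hb⟩ := exists_norm_symmRem_le (p := p + 1) (n := n + 1) (by push_cast; linarith)
  have habs : ∀ t, 0 < t → |σ * t| = t := fun t ht => by rw [abs_mul, hσ, one_mul, abs_of_pos ht]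
  have key := integral_Ioi_rpow_smul_deriv (p := p + 1) (a := (n + 1 : ℕ)) (b := b) (C := 4)
    (h := fun t => symmRem (p + 1) (n + 1) (σ * t)) (h' := fun t => σ • symmRem p n (σ * t))
    (by linarith) (fun t _ => ?_) (by push_cast; linarith) hpb
    (fun t ht => by simpa only [habs t ht] using norm_symmRem_le (p + 1) (n + 1) (σ * t))
    (fun t ht => by simpa only [habs t ht] using hb (σ * t)) ?_
  · rw [symmRemInt, key, symmRemInt]
    simp_rw [smul_comm _ σ, neg_add']
    rw [integral_smul, smul_smul, Complex.real_smul]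
    congr 2
    ring
  · exact (hasDerivAt_symmRem p n (σ * t)).scomp t
      (by simpa using (hasDerivAt_id t).const_mul σ)
  · simp_rw [smul_comm _ σ, neg_add']
    exact (integrableOn_symmRem hnp hpn hσ).smul σ

lemma symmRem_zero_eq (p s : ℝ) :
    symmRem p 0 s = ((2 * Real.sin (Real.pi * p / 2) * (1 - Real.cos s)
      + 2 * Real.cos (Real.pi * p / 2) * Real.sin s : ℝ) : ℂ) := by
  have hφ : Real.pi / 2 * (p + 1) = Real.pi * p / 2 + Real.pi / 2 := by ring
  have hinv (x : ℝ) : (Complex.exp (x * Complex.I))⁻¹ = Complex.exp ((-x : ℝ) * Complex.I) := by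
    rw [← Complex.exp_neg, Complex.ofReal_neg, neg_mul]
  have hneg : -(Complex.I * s) = (-s : ℝ) * Complex.I := by
    push_cast
    ring
  rw [symmRem, expRem_zero, expRem_zero, I_cpow_ofReal, neg_I_cpow_ofReal, hφ,
    div_eq_mul_inv (_ - _ : ℂ), div_eq_mul_inv (_ - _ : ℂ), hinv, hinv, neg_neg, hneg,
    mul_comm Complex.I]
  simp only [Complex.exp_ofReal_mul_I, Real.cos_neg, Real.sin_neg, Real.cos_add_pi_div_two,
    Real.sin_add_pi_div_two]
  push_cast
  linear_combination (-2 * Complex.cos (Real.pi * p / 2) * Complex.sin s) * Complex.I_sq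

lemma integral_exp_neg_mul_trig {v : ℝ} (hv : 0 < v) (a b : ℝ) :
    ∫ s in Ioi (0 : ℝ), (a * (1 - Real.cos s) + b * Real.sin s) * Real.exp (-(v * s))
      = a * (v⁻¹ - v * (1 + v ^ 2)⁻¹) + b * (1 + v ^ 2)⁻¹ := by
  have hre : (-v + Complex.I : ℂ).re < 0 := by simpa using hv
  have hi := integrableOn_exp_mul_complex_Ioi hre 0
  have hval := integral_exp_mul_complex_Ioi hre 0
  rw [Complex.ofReal_zero, mul_zero, Complex.exp_zero] at hval
  have hexp (s : ℝ) : Complex.exp ((-v + Complex.I) * s)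
      = ((Real.exp (-(v * s)) * Real.cos s : ℝ) : ℂ)
        + ((Real.exp (-(v * s)) * Real.sin s : ℝ) : ℂ) * Complex.I := by
    rw [add_mul, Complex.exp_add, mul_comm Complex.I, Complex.exp_ofReal_mul_I]
    push_cast
    ring_nf
  have hnz : (v ^ 2 + 1 : ℝ) ≠ 0 := by positivity
  have hquot : (-1 : ℂ) / (-v + Complex.I)
      = ((v * (1 + v ^ 2)⁻¹ : ℝ) : ℂ) + (((1 + v ^ 2)⁻¹ : ℝ) : ℂ) * Complex.I := by
    have h1 : (-v + Complex.I : ℂ) ≠ 0 := fun h => by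
      rw [h] at hre
      simp at hre
    have h2 : (1 + v ^ 2 : ℂ) ≠ 0 := by
      rw [add_comm]; exact_mod_cast hnz
    rw [div_eq_iff h1]
    push_cast
    field_simp
    linear_combination -Complex.I_sq
  have hre' (s : ℝ) : RCLike.re (Complex.exp ((-v + Complex.I) * s))
      = Real.exp (-(v * s)) * Real.cos s := by
    rw [hexp, RCLike.re_to_complex, Complex.add_re, Complex.ofReal_re, Complex.re_ofReal_mul,
      Complex.I_re, mul_zero, add_zero]
  have him' (s : ℝ) : RCLike.im (Complex.exp ((-v + Complex.I) * s))
      = Real.exp (-(v * s)) * Real.sin s := by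
    rw [hexp, RCLike.im_to_complex, Complex.add_im, Complex.ofReal_im, Complex.im_ofReal_mul,
      Complex.I_im, mul_one, zero_add]
  have hci : IntegrableOn (fun s : ℝ => Real.exp (-(v * s)) * Real.cos s) (Ioi 0) :=
    hi.re.congr (Eventually.of_forall hre')
  have hsi : IntegrableOn (fun s : ℝ => Real.exp (-(v * s)) * Real.sin s) (Ioi 0) :=
    hi.im.congr (Eventually.of_forall him')
  have hei : IntegrableOn (fun s : ℝ => Real.exp (-(v * s))) (Ioi 0) := by
    simpa using integrableOn_exp_mul_Ioi (a := -v) (by linarith) 0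
  have hev : ∫ s in Ioi (0 : ℝ), Real.exp (-(v * s)) = v⁻¹ := by
    simpa [neg_div_neg_eq] using integral_exp_mul_Ioi (a := -v) (by linarith) 0
  have hcv : ∫ s in Ioi (0 : ℝ), Real.exp (-(v * s)) * Real.cos s = v * (1 + v ^ 2)⁻¹ := by
    simp_rw [← hre']
    rw [integral_re hi, hval, hquot, RCLike.re_to_complex, Complex.add_re, Complex.ofReal_re,
      Complex.re_ofReal_mul, Complex.I_re, mul_zero, add_zero]
  have hsv : ∫ s in Ioi (0 : ℝ), Real.exp (-(v * s)) * Real.sin s = (1 + v ^ 2)⁻¹ := by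
    simp_rw [← him']
    rw [integral_im hi, hval, hquot, RCLike.im_to_complex, Complex.add_im, Complex.ofReal_im,
      Complex.im_ofReal_mul, Complex.I_im, mul_one, zero_add]
  have hai : IntegrableOn (fun s : ℝ => a * (Real.exp (-(v * s))
      - Real.exp (-(v * s)) * Real.cos s)) (Ioi 0) := (hei.sub hci).const_mul a
  rw [← hcv, ← hsv, ← hev, ← integral_sub hei hci, ← integral_const_mul, ← integral_const_mul,
    ← integral_add hai (hsi.const_mul b)]
  congr 1 with s
  ring

lemma Gamma_mul_symmRemInt_zero {p : ℝ} (hp : 0 < p) (hp1 : p ≤ 1) {σ : ℝ} (hσ : |σ| = 1) :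
    (Real.Gamma (p + 1) : ℂ) * symmRemInt p 0 σ
      = ((if p = 1 then Real.pi else (1 + σ) * Real.pi : ℝ) : ℂ) := by
  set θ := Real.pi * p / 2 with hθ
  have hsymm (s : ℝ) : symmRem p 0 (σ * s) = ((2 * Real.sin θ * (1 - Real.cos s)
      + 2 * σ * Real.cos θ * Real.sin s : ℝ) : ℂ) := by
    rw [symmRem_zero_eq, ← hθ]
    rcases eq_or_eq_neg_of_abs_eq hσ with rfl | rfl <;> simp
  have hi : IntegrableOn (fun s : ℝ => s ^ (-(p + 1)) • (2 * Real.sin θ * (1 - Real.cos s)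
      + 2 * σ * Real.cos θ * Real.sin s)) (Ioi 0) := by
    refine (integrableOn_symmRem (n := 0) (by simpa using hp) (by simpa using hp1) hσ).re.congr
      (Eventually.of_forall fun s => ?_)
    simp only [hsymm, neg_add']
    rw [Complex.real_smul, ← Complex.ofReal_mul, RCLike.re_to_complex, Complex.ofReal_re,
      smul_eq_mul]
  have hint : symmRemInt p 0 σ = ((∫ s in Ioi (0 : ℝ), s ^ (-(p + 1)) •
      (2 * Real.sin θ * (1 - Real.cos s) + 2 * σ * Real.cos θ * Real.sin s) : ℝ) : ℂ) := by
    rw [symmRemInt, ← integral_complex_ofReal]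
    congr 1 with s
    rw [hsymm, Complex.real_smul, ← Complex.ofReal_mul, neg_add', smul_eq_mul]
  rw [hint, ← Complex.ofReal_mul, Gamma_mul_integral_mul_rpow_neg (by linarith) (by fun_prop) hi]
  congr 1
  have hL : ∀ v ∈ Ioi (0 : ℝ), v ^ (p + 1 - 1) * ∫ s in Ioi (0 : ℝ),
      (2 * Real.sin θ * (1 - Real.cos s) + 2 * σ * Real.cos θ * Real.sin s) * Real.exp (-(v * s))
      = 2 * Real.sin θ * (v ^ (p - 1) * (1 + v ^ 2)⁻¹)
        + 2 * σ * Real.cos θ * (v ^ (p + 1 - 1) * (1 + v ^ 2)⁻¹) := fun v hv => by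
    have hv0 : 0 < v := hv
    have : 1 + v ^ 2 ≠ 0 := by positivity
    rw [integral_exp_neg_mul_trig hv0, add_sub_cancel_right, Real.rpow_sub_one hv0.ne']
    field_simp
    ring
  rw [setIntegral_congr_fun measurableSet_Ioi hL]
  have hsin : Real.sin θ ≠ 0 := (Real.sin_pos_of_pos_of_lt_pi (by positivity)
    (by rw [hθ]; nlinarith [Real.pi_pos])).ne'
  have hM := integral_rpow_div_one_add_sq hp (by linarith)
  have hMi := integrableOn_rpow_div_one_add_sq hp (by linarith)
  split_ifs with h1
  · have hcos : Real.cos θ = 0 := by rw [hθ, h1, mul_one, Real.cos_pi_div_two]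
    simp only [hcos, mul_zero, zero_mul, add_zero]
    rw [integral_const_mul, hM, ← hθ]
    field_simp
  · have hlt : p < 1 := lt_of_le_of_ne hp1 h1
    have hcos : Real.cos θ ≠ 0 := (Real.cos_pos_of_mem_Ioo
      ⟨by have := Real.pi_pos; have : 0 < θ := by positivity
          linarith, by rw [hθ]; nlinarith [Real.pi_pos]⟩).ne'
    rw [integral_add (hMi.const_mul _)
      ((integrableOn_rpow_div_one_add_sq (a := p + 1) (by linarith) (by linarith)).const_mul _),
      integral_const_mul, integral_const_mul, hM,
      integral_rpow_div_one_add_sq (a := p + 1) (by linarith) (by linarith), ← hθ,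
      show Real.pi * (p + 1) / 2 = θ + Real.pi / 2 by rw [hθ]; ring, Real.sin_add_pi_div_two]
    field_simp

lemma Gamma_mul_symmRemInt {p : ℝ} {n : ℕ} (hnp : n < p) (hpn : p ≤ n + 1) {σ : ℝ}
    (hσ : |σ| = 1) :
    (Real.Gamma (p + 1) : ℂ) * symmRemInt p n σ
      = ((σ ^ n * if p = n + 1 then Real.pi else (1 + σ) * Real.pi : ℝ) : ℂ) := by
  induction n generalizing p with
  | zero =>
    simpa using Gamma_mul_symmRemInt_zero (by simpa using hnp) (by simpa using hpn) hσ
  | succ n ih =>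
    push_cast at hnp hpn
    obtain ⟨p, rfl⟩ : ∃ q, p = q + 1 := ⟨p - 1, by ring⟩
    have hn := Nat.cast_nonneg (α := ℝ) n
    have h1 : (n : ℝ) < p := by linarith
    have h2 : p ≤ n + 1 := by linarith
    have hne : p + 1 ≠ 0 := by linarith
    have hne' : (p + 1 : ℂ) ≠ 0 := by exact_mod_cast hne
    have := ih h1 h2
    rw [symmRemInt_succ h1 h2 hσ, Real.Gamma_add_one hne]
    simp only [Nat.cast_add_one, add_left_inj]
    rw [pow_succ, mul_right_comm, Complex.ofReal_mul _ σ, ← this]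
    push_cast
    field_simp

/-- Scaling of the integral of the symmetrised remainder. -/
lemma integral_rpow_smul_comp_mul {E : Type*} [NormedAddCommGroup E] [NormedSpace ℝ E]
    (f : ℝ → E) (p : ℝ) {x : ℝ} (hx : x ≠ 0) :
    ∫ t in Ioi (0 : ℝ), t ^ (-p - 1) • f (t * x)
      = |x| ^ p • ∫ t in Ioi (0 : ℝ), t ^ (-p - 1) • f (SignType.sign x * t) := by
  have hx' : 0 < |x| := abs_pos.2 hx
  have hscale := integral_comp_mul_left_Ioi
    (fun t : ℝ => t ^ (-p - 1) • f (SignType.sign x * t)) 0 hx'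
  rw [mul_zero] at hscale
  have hpt : ∀ t ∈ Ioi (0 : ℝ), t ^ (-p - 1) • f (t * x)
      = |x| ^ (p + 1) • ((|x| * t) ^ (-p - 1) • f (SignType.sign x * (|x| * t))) := fun t ht => by
    rw [smul_smul, Real.mul_rpow hx'.le (le_of_lt ht), ← mul_assoc, ← Real.rpow_add hx',
      show p + 1 + (-p - 1) = 0 by ring, Real.rpow_zero, one_mul, ← mul_assoc, sign_mul_abs,
      mul_comm t]
  rw [setIntegral_congr_fun measurableSet_Ioi hpt, integral_smul, hscale, smul_smul,
    Real.rpow_add_one hx'.ne', mul_assoc, mul_inv_cancel₀ hx'.ne', mul_one]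

lemma integrableOn_rpow_smul_comp_mul {E : Type*} [NormedAddCommGroup E] [NormedSpace ℝ E]
    {f : ℝ → E} {p x : ℝ} (hx : x ≠ 0)
    (hf : IntegrableOn (fun t : ℝ => t ^ (-p - 1) • f (SignType.sign x * t)) (Ioi 0)) :
    IntegrableOn (fun t : ℝ => t ^ (-p - 1) • f (t * x)) (Ioi 0) := by
  have hx' : 0 < |x| := abs_pos.2 hx
  have hscale := (integrableOn_Ioi_comp_mul_left_iff
    (fun t : ℝ => t ^ (-p - 1) • f (SignType.sign x * t)) 0 hx').2 (by rwa [mul_zero])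
  refine (integrableOn_congr_fun (fun t ht => ?_) measurableSet_Ioi).1
    (hscale.smul (|x| ^ (p + 1)))
  simp only [Pi.smul_apply]
  rw [smul_smul, Real.mul_rpow hx'.le (le_of_lt ht), ← mul_assoc, ← Real.rpow_add hx',
      show p + 1 + (-p - 1) = 0 by ring, Real.rpow_zero, one_mul, ← mul_assoc, sign_mul_abs,
      mul_comm t]

lemma rcpow_of_ne_zero {x : ℝ} (hx : x ≠ 0) (s : ℝ) : rcpow x s = (x : ℂ) ^ (s : ℂ) := if_neg hx

lemma rcpow_zero_left (s : ℝ) : rcpow 0 s = 0 := if_pos rfl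

lemma rcpow_of_pos {x : ℝ} (hx : 0 < x) (s : ℝ) : rcpow x s = ((x ^ s : ℝ) : ℂ) := by
  rw [rcpow_of_ne_zero hx.ne', Complex.ofReal_cpow hx.le]

lemma norm_rcpow {x : ℝ} (hx : x ≠ 0) (s : ℝ) : ‖rcpow x s‖ = |x| ^ s := by
  rw [rcpow_of_ne_zero hx, Complex.norm_cpow_real, Complex.norm_real, Real.norm_eq_abs]

lemma rcpow_add_natCast {x : ℝ} (hx : x ≠ 0) (s : ℝ) (j : ℕ) :
    rcpow x (s + j) = rcpow x s * (x : ℂ) ^ j := by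
  have hx' : (x : ℂ) ≠ 0 := by exact_mod_cast hx
  rw [rcpow_of_ne_zero hx, rcpow_of_ne_zero hx, Complex.ofReal_add, Complex.cpow_add _ _ hx',
    Complex.ofReal_natCast, Complex.cpow_natCast]

lemma measurable_rcpow (s : ℝ) : Measurable fun x => rcpow x s :=
  Measurable.ite (measurableSet_singleton 0) measurable_const
    (Complex.measurable_ofReal.pow_const _)

lemma norm_rcpow_le_add {a b s : ℝ} (has : a ≤ s) (hsb : s ≤ b) (x : ℝ) :
    ‖rcpow x s‖ ≤ |x| ^ a + |x| ^ b := by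
  have h1 : 0 ≤ |x| ^ a := by positivity
  have h2 : 0 ≤ |x| ^ b := by positivity
  rcases eq_or_ne x 0 with rfl | hx
  · rw [rcpow_zero_left, norm_zero]
    exact add_nonneg h1 h2
  · rw [norm_rcpow hx]
    rcases le_total |x| 1 with h | h
    · linarith [Real.rpow_le_rpow_of_exponent_ge (abs_pos.2 hx) h has]
    · linarith [Real.rpow_le_rpow_of_exponent_le h hsb]

lemma mul_ofReal_cpow {c : ℂ} (hc : c ≠ 0) {t : ℝ} (ht : 0 < t) (s : ℝ) :
    (c * t) ^ (s : ℂ) = c ^ (s : ℂ) * (t ^ s : ℝ) := by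
  have ht' : (t : ℂ) ≠ 0 := by exact_mod_cast ht.ne'
  rw [Complex.cpow_def_of_ne_zero (mul_ne_zero hc ht'), mul_comm c, Complex.log_ofReal_mul ht hc,
    add_mul, Complex.exp_add, Complex.cpow_def_of_ne_zero hc, Real.rpow_def_of_pos ht, mul_comm]
  push_cast
  rfl

/-- The pointwise form of the inversion formula. -/
lemma posPow_eq {p r : ℝ} {ℓ : ℕ} (h1 : ℓ < p) (h2 : p ≤ ℓ + 1) (x : ℝ) :
    (posPow x (r + p) : ℂ)
      = (if p = ℓ + 1 then (starRingEnd ℂ) (rcpow x (p + r)) / 2 else 0)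
        + Real.Gamma (p + 1) / (2 * Real.pi) * ((starRingEnd ℂ) (rcpow x r)
          * ((|x| ^ p : ℝ) * symmRemInt p ℓ (SignType.sign x))) := by
  have hπ : (Real.pi : ℂ) ≠ 0 := by exact_mod_cast Real.pi_ne_zero
  rcases lt_trichotomy x 0 with hx | rfl | hx
  · have hG := Gamma_mul_symmRemInt h1 h2 (σ := (-1)) (by simp)
    rw [sign_neg hx, SignType.coe_neg_one, posPow, if_neg hx.not_gt,
      show Real.Gamma (p + 1) / (2 * Real.pi) * ((starRingEnd ℂ) (rcpow x r)
          * ((|x| ^ p : ℝ) * symmRemInt p ℓ (-1))) = (starRingEnd ℂ) (rcpow x r)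
          * (|x| ^ p : ℝ) * (Real.Gamma (p + 1) * symmRemInt p ℓ (-1)) / (2 * Real.pi) by ring, hG]
    split_ifs with h
    · subst h
      rw [add_comm ((ℓ : ℝ) + 1), ← Nat.cast_add_one, rcpow_add_natCast hx.ne, map_mul, map_pow,
        Complex.conj_ofReal, Real.rpow_natCast, abs_of_neg hx, neg_pow x]
      have : ((-1 : ℂ) ^ ℓ) ^ 2 = 1 := by rw [← pow_mul, mul_comm, pow_mul]; simp
      push_cast
      field_simp
      linear_combination (starRingEnd ℂ) (rcpow x r) * x ^ (ℓ + 1) * this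
    · simp
  · simp [posPow, rcpow_zero_left]
  · have hG := Gamma_mul_symmRemInt h1 h2 (σ := 1) (by simp)
    rw [sign_pos hx, SignType.coe_one, posPow, if_pos hx,
      show Real.Gamma (p + 1) / (2 * Real.pi) * ((starRingEnd ℂ) (rcpow x r)
          * ((|x| ^ p : ℝ) * symmRemInt p ℓ 1)) = (starRingEnd ℂ) (rcpow x r)
          * (|x| ^ p : ℝ) * (Real.Gamma (p + 1) * symmRemInt p ℓ 1) / (2 * Real.pi) by ring, hG,
      rcpow_of_pos hx, rcpow_of_pos hx, Complex.conj_ofReal, Complex.conj_ofReal, abs_of_pos hx,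
      Real.rpow_add hx, Real.rpow_add hx]
    split_ifs with h
    · push_cast
      field_simp
      ring
    · push_cast
      field_simp
      ring

section

variable {Ω : Type*} [MeasurableSpace Ω] {μ : Measure Ω} {X : Ω → ℝ} {p r : ℝ} {ℓ : ℕ}

lemma norm_exp_I_mul_ofReal_mul_ofReal (w x : ℝ) : ‖Complex.exp (Complex.I * w * x)‖ = 1 := by
  rw [show Complex.I * w * x = (w * x : ℝ) * Complex.I by push_cast; ring,
    Complex.norm_exp_ofReal_mul_I]

lemma integrable_conj_rcpow_mul_exp (hX : Measurable X)
    (hmr : Integrable (fun ω => |X ω| ^ r) μ) (hmrp : Integrable (fun ω => |X ω| ^ (r + p)) μ)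
    {s : ℝ} (hs : r ≤ s) (hs' : s ≤ r + p) (w : ℝ) :
    Integrable (fun ω => (starRingEnd ℂ) (rcpow (X ω) s)
      * Complex.exp (Complex.I * w * X ω)) μ := by
  have hm : Measurable fun ω => rcpow (X ω) s := (measurable_rcpow s).comp hX
  refine (hmr.add hmrp).mono' (Measurable.aestronglyMeasurable ?_) (Eventually.of_forall fun ω => ?_)
  · exact (Complex.continuous_conj.measurable.comp hm).mul (by fun_prop)
  · rw [norm_mul, norm_exp_I_mul_ofReal_mul_ofReal, mul_one, RCLike.norm_conj]
    exact norm_rcpow_le_add hs hs' _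

lemma fracDeriv_add_natCast (r w : ℝ) (j : ℕ) :
    fracDeriv μ X (r + j) w = Complex.I ^ (r : ℂ) * ∫ ω, (starRingEnd ℂ) (rcpow (X ω) r)
      * Complex.exp (Complex.I * w * X ω) * (Complex.I * X ω) ^ j ∂μ := by
  rw [fracDeriv, Complex.ofReal_add, Complex.cpow_add _ _ Complex.I_ne_zero,
    Complex.ofReal_natCast, Complex.cpow_natCast, mul_assoc, ← integral_const_mul]
  congr 2 with ω
  rcases eq_or_ne (X ω) 0 with h | h
  · simp [h, rcpow_zero_left]
  · rw [rcpow_add_natCast h, map_mul, map_pow, Complex.conj_ofReal]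
    ring

lemma fracDeriv_sub_sum_eq (hX : Measurable X)
    (hmr : Integrable (fun ω => |X ω| ^ r) μ) (hmrp : Integrable (fun ω => |X ω| ^ (r + p)) μ)
    (hp : 0 < p) (hℓ : ℓ < p) (u δ : ℝ) :
    Integrable (fun ω => (starRingEnd ℂ) (rcpow (X ω) r) * Complex.exp (Complex.I * u * X ω)
      * expRem ℓ (Complex.I * (δ * X ω : ℝ))) μ ∧
    fracDeriv μ X r (u + δ)
      - ∑ j ∈ Finset.range (ℓ + 1), fracDeriv μ X (r + j) u * (δ : ℂ) ^ j / (Nat.factorial j)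
    = Complex.I ^ (r : ℂ) * ∫ ω, (starRingEnd ℂ) (rcpow (X ω) r)
      * Complex.exp (Complex.I * u * X ω) * expRem ℓ (Complex.I * (δ * X ω : ℝ)) ∂μ := by
  set A : Ω → ℂ := fun ω => (starRingEnd ℂ) (rcpow (X ω) r)
    * Complex.exp (Complex.I * u * X ω) with hA
  have hj : ∀ j ∈ Finset.range (ℓ + 1), Integrable (fun ω => A ω * (Complex.I * X ω) ^ j) μ := by
    intro j hj
    have hjp : (j : ℝ) ≤ p :=
      le_trans (by exact_mod_cast Nat.lt_succ_iff.1 (Finset.mem_range.1 hj)) hℓ.le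
    refine ((integrable_conj_rcpow_mul_exp hX hmr hmrp (s := r + j) (by simp) (by simpa)
      u).const_mul (Complex.I ^ j)).congr (Eventually.of_forall fun ω => ?_)
    rcases eq_or_ne (X ω) 0 with h | h
    · simp [h, hA, rcpow_zero_left]
    · simp only [hA]
      rw [rcpow_add_natCast h, map_mul, map_pow, Complex.conj_ofReal]
      ring
  have hj' : ∀ j ∈ Finset.range (ℓ + 1), Integrable
      (fun ω => A ω * (Complex.I * X ω) ^ j * ((δ : ℂ) ^ j / (Nat.factorial j))) μ :=
    fun j h => (hj j h).mul_const _
  have h0 : Integrable (fun ω => (starRingEnd ℂ) (rcpow (X ω) r)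
      * Complex.exp (Complex.I * (u + δ : ℝ) * X ω)) μ :=
    integrable_conj_rcpow_mul_exp hX hmr hmrp le_rfl (by linarith) (u + δ)
  have hpt (ω : Ω) : A ω * expRem ℓ (Complex.I * (δ * X ω : ℝ))
      = (starRingEnd ℂ) (rcpow (X ω) r) * Complex.exp (Complex.I * (u + δ : ℝ) * X ω)
        - ∑ j ∈ Finset.range (ℓ + 1),
          A ω * (Complex.I * X ω) ^ j * ((δ : ℂ) ^ j / (Nat.factorial j)) := by
    rw [expRem, mul_sub, Finset.mul_sum, hA]
    congr 1
    · rw [mul_assoc, ← Complex.exp_add]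
      push_cast
      ring_nf
    · refine Finset.sum_congr rfl fun j _ => ?_
      push_cast
      ring
  change Integrable (fun ω => A ω * expRem ℓ (Complex.I * (δ * X ω : ℝ))) μ ∧
    _ = _ * ∫ ω, A ω * expRem ℓ (Complex.I * (δ * X ω : ℝ)) ∂μ
  simp_rw [hpt]
  refine ⟨h0.sub (integrable_finsetSum _ hj'), ?_⟩
  rw [integral_sub h0 (integrable_finsetSum _ hj'), integral_finsetSum _ hj', mul_sub,
    Finset.mul_sum]
  congr 1
  refine Finset.sum_congr rfl fun j _ => ?_
  rw [fracDeriv_add_natCast, integral_mul_const]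
  ring

lemma integrable_uncurry_symmRem [SFinite μ] (hX : Measurable X)
    (hmrp : Integrable (fun ω => |X ω| ^ (r + p)) μ) (hℓ : ℓ < p) (hℓ' : p ≤ ℓ + 1) (u : ℝ) :
    Integrable (Function.uncurry fun ω (t : ℝ) => (starRingEnd ℂ) (rcpow (X ω) r)
      * Complex.exp (Complex.I * u * X ω) * (t ^ (-p - 1) • symmRem p ℓ (t * X ω)))
      (μ.prod (volume.restrict (Ioi 0))) := by
  have hσ {x : ℝ} (hx : x ≠ 0) : |(SignType.sign x : ℝ)| = 1 := by
    rcases hx.lt_or_gt with h | h <;> simp [h]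
  have hmeas : Measurable (Function.uncurry fun ω (t : ℝ) => (starRingEnd ℂ) (rcpow (X ω) r)
      * Complex.exp (Complex.I * u * X ω) * (t ^ (-p - 1) • symmRem p ℓ (t * X ω))) := by
    have h1 : Measurable fun z : Ω × ℝ => (starRingEnd ℂ) (rcpow (X z.1) r) :=
      Complex.continuous_conj.measurable.comp
        ((measurable_rcpow r).comp (hX.comp measurable_fst))
    have h2 : Measurable fun z : Ω × ℝ => symmRem p ℓ (z.2 * X z.1) :=
      (continuous_symmRem p ℓ).measurable.comp (by fun_prop)
    simp only [Function.uncurry_def]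
    fun_prop
  set D : ℝ → ℝ := fun σ => ∫ t in Ioi (0 : ℝ), t ^ (-p - 1) • ‖symmRem p ℓ (σ * t)‖
  refine (integrable_prod_iff hmeas.aestronglyMeasurable).2 ⟨Eventually.of_forall fun ω => ?_, ?_⟩
  · rcases eq_or_ne (X ω) 0 with h | h
    · simp [h, rcpow_zero_left]
    · exact (integrableOn_rpow_smul_comp_mul h
        (integrableOn_symmRem hℓ hℓ' (hσ h))).const_mul
        ((starRingEnd ℂ) (rcpow (X ω) r) * Complex.exp (Complex.I * u * X ω))
  · refine (hmrp.mul_const (|D 1| + |D (-1)|)).mono'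
      hmeas.norm.stronglyMeasurable.integral_prod_right.aestronglyMeasurable
      (Eventually.of_forall fun ω => ?_)
    rw [Real.norm_of_nonneg (integral_nonneg fun _ => norm_nonneg _)]
    rcases eq_or_ne (X ω) 0 with h | h
    · simp only [Function.uncurry, h, rcpow_zero_left, map_zero, zero_mul, norm_zero,
        integral_zero]
      positivity
    · have hpt : ∀ t ∈ Ioi (0 : ℝ), ‖Function.uncurry (fun ω (t : ℝ) =>
          (starRingEnd ℂ) (rcpow (X ω) r) * Complex.exp (Complex.I * u * X ω)
            * (t ^ (-p - 1) • symmRem p ℓ (t * X ω))) (ω, t)‖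
          = |X ω| ^ r * (t ^ (-p - 1) • ‖symmRem p ℓ (t * X ω)‖) := fun t ht => by
        rw [Function.uncurry_apply_pair, norm_mul, norm_mul, RCLike.norm_conj, norm_rcpow h,
          norm_exp_I_mul_ofReal_mul_ofReal, mul_one, norm_smul,
          Real.norm_of_nonneg (Real.rpow_nonneg (le_of_lt ht) _), smul_eq_mul]
      rw [setIntegral_congr_fun measurableSet_Ioi hpt, integral_const_mul,
        integral_rpow_smul_comp_mul (fun s => ‖symmRem p ℓ s‖) p h, smul_eq_mul, ← mul_assoc,
        ← Real.rpow_add (abs_pos.2 h)]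
      refine mul_le_mul_of_nonneg_left ?_ (by positivity)
      rcases h.lt_or_gt with h | h
      · rw [sign_neg h, SignType.coe_neg_one]
        exact (le_abs_self _).trans (le_add_of_nonneg_left (abs_nonneg _))
      · rw [sign_pos h, SignType.coe_one]
        exact (le_abs_self _).trans (le_add_of_nonneg_right (abs_nonneg _))

end

theorem stmt6 {Ω : Type*} [MeasurableSpace Ω] (μ : Measure Ω) [IsProbabilityMeasure μ]
    (p r u : ℝ) (hp : 0 < p) (X : Ω → ℝ) (hX : Measurable X)
    (hmr : Integrable (fun ω => |X ω| ^ r) μ)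
    (hmrp : Integrable (fun ω => |X ω| ^ (r + p)) μ)
    (h0 : r < 0 ∨ r + p < 0 → μ {ω | X ω = 0} = 0)
    (ℓ : ℕ) (hl : ℓ = ⌈p - 1⌉₊)
    (R : ℝ → ℝ → ℂ)
    (hR : R = fun w δ => fracDeriv μ X r (w + δ)
      - ∑ j ∈ Finset.range (ℓ + 1), fracDeriv μ X (r + j) w * (δ : ℂ) ^ j / (Nat.factorial j)) :
    IntegrableOn
      (fun t => R u t / (Complex.I * t) ^ ((p + 1 : ℝ) : ℂ)
        + R u (-t) / (-(Complex.I * t)) ^ ((p + 1 : ℝ) : ℂ)) (Ioi 0) volume ∧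
    (∫ ω, (posPow (X ω) (r + p) : ℂ) * Complex.exp (Complex.I * u * X ω) ∂μ)
      = (if ∃ n : ℕ, 0 < n ∧ (n : ℝ) = p then
          fracDeriv μ X (p + r) u / (2 * Complex.I ^ ((p + r : ℝ) : ℂ)) else 0)
        + (Real.Gamma (p + 1) : ℂ) / (2 * Real.pi * Complex.I ^ ((r : ℝ) : ℂ))
          * ∫ t in Ioi (0:ℝ),
              (R u t / (Complex.I * t) ^ ((p + 1 : ℝ) : ℂ)
                + R u (-t) / (-(Complex.I * t)) ^ ((p + 1 : ℝ) : ℂ)) := by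
  have hpos : ((⌈p - 1⌉₊ : ℕ) : ℝ) < p := by
    rcases le_total p 1 with h | h
    · rw [Nat.ceil_eq_zero.2 (by linarith)]
      simpa using hp
    · linarith [Nat.ceil_lt_add_one (sub_nonneg.2 h)]
  have hℓ : (ℓ : ℝ) < p := hl ▸ hpos
  have hℓ' : p ≤ ℓ + 1 := by
    have := Nat.le_ceil (p - 1)
    rw [hl]
    linarith
  have hI : Complex.I ^ (r : ℂ) ≠ 0 := by
    rw [I_cpow_ofReal]
    exact Complex.exp_ne_zero _
  set A : Ω → ℂ := fun ω => (starRingEnd ℂ) (rcpow (X ω) r)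
    * Complex.exp (Complex.I * u * X ω) with hA
  have hK : Integrable (Function.uncurry fun ω (t : ℝ) =>
      A ω * (t ^ (-p - 1) • symmRem p ℓ (t * X ω))) (μ.prod (volume.restrict (Ioi 0))) :=
    integrable_uncurry_symmRem hX hmrp hℓ hℓ' u
  have hint : ∀ t ∈ Ioi (0 : ℝ), R u t / (Complex.I * t) ^ ((p + 1 : ℝ) : ℂ)
      + R u (-t) / (-(Complex.I * t)) ^ ((p + 1 : ℝ) : ℂ)
      = Complex.I ^ (r : ℂ) * ∫ ω, A ω * (t ^ (-p - 1) • symmRem p ℓ (t * X ω)) ∂μ := by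
    intro t ht
    have ht0 : 0 < t := ht
    obtain ⟨hi₁, he₁⟩ := fracDeriv_sub_sum_eq hX hmr hmrp hp hℓ u t
    obtain ⟨hi₂, he₂⟩ := fracDeriv_sub_sum_eq hX hmr hmrp hp hℓ u (-t)
    have hR₁ : R u t = _ := (congrFun (congrFun hR u) t).trans he₁
    have hR₂ : R u (-t) = _ := (congrFun (congrFun hR u) (-t)).trans he₂
    rw [hR₁, hR₂, ← neg_mul, mul_ofReal_cpow Complex.I_ne_zero ht0,
      mul_ofReal_cpow (neg_ne_zero.2 Complex.I_ne_zero) ht0, mul_div_assoc, mul_div_assoc,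
      ← mul_add, ← integral_div, ← integral_div, ← integral_add (hi₁.div_const _)
        (hi₂.div_const _)]
    congr 2 with ω
    have htp : t ^ (-p - 1) = (t ^ (p + 1))⁻¹ := by
      rw [← Real.rpow_neg ht0.le, neg_add']
    have hneg : Complex.I * ((-t * X ω : ℝ) : ℂ) = -(Complex.I * ((t * X ω : ℝ) : ℂ)) := by
      push_cast
      ring
    rw [symmRem, htp, Complex.real_smul, hneg, Complex.ofReal_inv]
    simp only [hA, div_eq_mul_inv, mul_inv]
    ring
  have hinner (ω : Ω) : ∫ t in Ioi (0 : ℝ), A ω * (t ^ (-p - 1) • symmRem p ℓ (t * X ω))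
      = A ω * ((|X ω| ^ p : ℝ) * symmRemInt p ℓ (SignType.sign (X ω))) := by
    rcases eq_or_ne (X ω) 0 with h | h
    · simp [hA, h, rcpow_zero_left]
    · rw [integral_const_mul, integral_rpow_smul_comp_mul _ _ h, Complex.real_smul, symmRemInt]
  refine ⟨(integrableOn_congr_fun hint measurableSet_Ioi).2
    (hK.integral_prod_right.const_mul _), ?_⟩
  have hiff : (∃ n : ℕ, 0 < n ∧ (n : ℝ) = p) ↔ p = ℓ + 1 := by
    refine ⟨?_, fun h => ⟨ℓ + 1, Nat.succ_pos _, by rw [h]; push_cast; rfl⟩⟩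
    rintro ⟨n, -, rfl⟩
    have h1 : ℓ < n := by exact_mod_cast hℓ
    have h2 : n ≤ ℓ + 1 := by exact_mod_cast hℓ'
    exact_mod_cast le_antisymm h2 h1
  have hKi : Integrable (fun ω => A ω * ((|X ω| ^ p : ℝ)
      * symmRemInt p ℓ (SignType.sign (X ω)))) μ :=
    hK.integral_prod_left.congr (Eventually.of_forall hinner)
  have hNi := (integrable_conj_rcpow_mul_exp hX hmr hmrp (s := p + r) (by linarith)
    (by linarith) u).mul_const (if p = ℓ + 1 then (1 / 2 : ℂ) else 0)
  have hlhs (ω : Ω) : (posPow (X ω) (r + p) : ℂ) * Complex.exp (Complex.I * u * X ω)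
      = (starRingEnd ℂ) (rcpow (X ω) (p + r)) * Complex.exp (Complex.I * u * X ω)
          * (if p = ℓ + 1 then (1 / 2 : ℂ) else 0)
        + Real.Gamma (p + 1) / (2 * Real.pi)
          * (A ω * ((|X ω| ^ p : ℝ) * symmRemInt p ℓ (SignType.sign (X ω)))) := by
    rw [posPow_eq hℓ hℓ', hA]
    split_ifs <;> ring
  simp_rw [hlhs, hiff]
  rw [integral_add hNi (hKi.const_mul _), integral_mul_const, integral_const_mul,
    setIntegral_congr_fun measurableSet_Ioi hint, integral_const_mul, ← integral_integral_swap hK,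
    integral_congr_ae (Eventually.of_forall hinner)]
  congr 1
  · split_ifs
    · have : Complex.I ^ ((p + r : ℝ) : ℂ) ≠ 0 := by
        rw [I_cpow_ofReal]
        exact Complex.exp_ne_zero _
      rw [fracDeriv]
      field_simp
    · rw [mul_zero]
  · field_simp
end

section
/- Let p ∈ (0,∞) and u ∈ ℝ, and let X be a real random variable with E|X|^p < ∞ and characteristic function f. Set ℓ := ⌈p−1⌉ (a nonnegative integer ≤ p) and λ := p − ℓ ∈ (0,1]. Then the function t ↦ (f^{(ℓ)}(u+t) − f^{(ℓ)}(u))/(it)^{λ+1} + (f^{(ℓ)}(u−t) − f^{(ℓ)}(u))/(−it)^{λ+1} is Lebesgue integrable on (0,∞) and E[X_+^p·e^{iuX}] = ( f^{(p)}(u)/(2·i^p) )·𝟙{p ∈ ℕ} + ( Γ(λ+1)/(2π·i^ℓ) ) · ∫_0^∞ ( (f^{(ℓ)}(u+t) − f^{(ℓ)}(u))/(it)^{λ+1} + (f^{(ℓ)}(u−t) − f^{(ℓ)}(u))/(−it)^{λ+1} ) dt, where f^{(ℓ)} denotes the ℓ-th derivative of f (and f^{(p)} the p-th derivative when p is a positive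 integer). -/
open MeasureTheory Filter Set Topology
open scoped Classical

/-- The characteristic function of a real random variable `X` on `(Ω, μ)`. -/
noncomputable def cf {Ω : Type*} [MeasurableSpace Ω] (μ : Measure Ω) (X : Ω → ℝ) (t : ℝ) : ℂ :=
  ∫ ω, Complex.exp (Complex.I * t * X ω) ∂μ

lemma integrable_withDensity_rpow_iff {a : ℝ} {E : Type*} [NormedAddCommGroup E] [NormedSpace ℝ E]
    (g : ℝ → E) :
    Integrable g ((volume.restrict (Ioi 0)).withDensity fun t => ENNReal.ofReal (t ^ a)) ↔
      IntegrableOn (fun t => t ^ a • g t) (Ioi 0) := by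
  rw [integrable_withDensity_iff_integrable_smul' (by fun_prop) (by simp)]
  refine integrable_congr ?_
  filter_upwards [ae_restrict_mem measurableSet_Ioi] with t ht
  rw [ENNReal.toReal_ofReal (Real.rpow_nonneg (le_of_lt ht) _)]

lemma integral_withDensity_rpow {a : ℝ} {E : Type*} [NormedAddCommGroup E] [NormedSpace ℝ E]
    (g : ℝ → E) :
    ∫ t, g t ∂((volume.restrict (Ioi 0)).withDensity fun t => ENNReal.ofReal (t ^ a)) =
      ∫ t in Ioi 0, t ^ a • g t := by
  rw [integral_withDensity_eq_integral_toReal_smul (by fun_prop) (by simp)]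
  refine setIntegral_congr_fun measurableSet_Ioi fun t ht => ?_
  rw [ENNReal.toReal_ofReal (Real.rpow_nonneg (le_of_lt ht) _)]

lemma integrableOn_rpow_mul_exp_neg_mul {a r : ℝ} (ha : 0 < a) (hr : 0 < r) :
    IntegrableOn (fun t : ℝ => t ^ (a - 1) * Real.exp (-(r * t))) (Ioi 0) := by
  by_contra h
  have h0 := (Real.integral_rpow_mul_exp_neg_mul_Ioi ha hr).symm.trans (integral_undef h)
  have := Real.Gamma_pos_of_pos ha
  exact (ne_of_gt (by positivity)) h0

lemma integral_rpow_mul_cexp_neg_mul_Ioi {a : ℝ} {r : ℂ} (ha : 0 < a) (hr : 0 < r.re) :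
    IntegrableOn (fun t : ℝ => ((t ^ (a - 1) : ℝ) : ℂ) * Complex.exp (-r * t)) (Ioi 0) ∧
    ∫ t : ℝ in Ioi 0, ((t ^ (a - 1) : ℝ) : ℂ) * Complex.exp (-r * t)
      = (1 / r) ^ (a : ℂ) * Complex.Gamma a := by
  constructor
  · refine (integrable_norm_iff (by fun_prop)).1 ?_
    refine (integrableOn_rpow_mul_exp_neg_mul ha hr).congr_fun (fun t ht => ?_) measurableSet_Ioi
    simp only
    rw [norm_mul, Complex.norm_real, Real.norm_of_nonneg (Real.rpow_nonneg (le_of_lt ht) _),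
      Complex.norm_exp]
    simp
  set m := (volume.restrict (Ioi (0 : ℝ))).withDensity fun t => ENNReal.ofReal (t ^ (a - 1))
    with hm
  have hset : Iio 0 ⊆ interior (ProbabilityTheory.integrableExpSet id m) := by
    refine interior_maximal (fun x hx => ?_) isOpen_Iio
    rw [ProbabilityTheory.integrableExpSet, mem_ofPred_eq, hm, integrable_withDensity_rpow_iff]
    simpa using integrableOn_rpow_mul_exp_neg_mul ha (neg_pos.2 hx)
  have hU : IsPreconnected {z : ℂ | z.re < 0} := (convex_halfSpace_re_lt 0).isPreconnected
  have hf : AnalyticOnNhd ℂ (ProbabilityTheory.complexMGF id m) {z | z.re < 0} :=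
    ProbabilityTheory.analyticOnNhd_complexMGF.mono fun z hz => hset hz
  have hg : AnalyticOnNhd ℂ (fun z : ℂ => (1 / -z) ^ (a : ℂ) * Complex.Gamma a)
      {z | z.re < 0} := by
    refine DifferentiableOn.analyticOnNhd (fun z hz => ?_)
      (isOpen_Iio.preimage Complex.continuous_re)
    have hz' : z.re < 0 := hz
    have hz0 : -z ≠ 0 := by rintro h; rw [neg_eq_zero.1 h] at hz'; simp at hz'
    refine DifferentiableAt.differentiableWithinAt (DifferentiableAt.mul_const ?_ _)
    refine DifferentiableAt.cpow_const ?_ ?_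
    · exact (differentiableAt_const _).div differentiableAt_id.neg hz0
    · rw [one_div]
      left
      rw [Complex.inv_re]
      exact div_pos (by simpa using hz') (Complex.normSq_pos.2 hz0)
  have hcoe : Tendsto (fun x : ℝ => (x : ℂ)) (𝓝[≠] (-1)) (𝓝[≠] (-1)) := by
    have h : Continuous (fun x : ℝ => (x : ℂ)) := Complex.continuous_ofReal
    refine tendsto_nhdsWithin_iff.2 ⟨?_, ?_⟩
    · simpa using (h.tendsto (-1)).mono_left nhdsWithin_le_nhds
    · filter_upwards [self_mem_nhdsWithin] with x hx hx'
      exact hx (Complex.ofReal_injective (by simpa using hx'))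
  have hev : ∀ᶠ x : ℝ in 𝓝[≠] (-1), ProbabilityTheory.complexMGF id m x
      = (1 / -(x : ℂ)) ^ (a : ℂ) * Complex.Gamma a := by
    filter_upwards [nhdsWithin_le_nhds (Iio_mem_nhds (show (-1 : ℝ) < 0 by norm_num))] with x hx
    have hx : 0 < -x := neg_pos.2 hx
    have h := Real.integral_rpow_mul_exp_neg_mul_Ioi ha hx
    rw [ProbabilityTheory.complexMGF_ofReal, ProbabilityTheory.mgf, hm, integral_withDensity_rpow]
    simp only [neg_mul, neg_neg] at h
    simp only [smul_eq_mul, id]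
    rw [h, Complex.ofReal_mul, Complex.ofReal_cpow (by positivity), Complex.Gamma_ofReal]
    push_cast
    rfl
  have hEq := hf.eqOn_of_preconnected_of_frequently_eq hg hU (z₀ := -1) (by simp)
    (hcoe.frequently (p := fun z => ProbabilityTheory.complexMGF id m z
      = (1 / -z) ^ (a : ℂ) * Complex.Gamma a) hev.frequently)
  have h := hEq (show (-r).re < 0 by simpa using hr)
  simp only [neg_neg] at h
  rw [← h, ProbabilityTheory.complexMGF, hm, integral_withDensity_rpow]
  simp

lemma integrableOn_min_pow_mul_rpow {s : ℝ} {k : ℕ} (hs : 0 < s) (hk : s < k) :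
    IntegrableOn (fun t : ℝ => min (t ^ k) 1 * t ^ (-s - 1)) (Ioi 0) := by
  rw [← Ioc_union_Ioi_eq_Ioi zero_le_one]
  refine IntegrableOn.union ?_ ?_
  · have h : IntegrableOn (fun t : ℝ => t ^ ((k : ℝ) - s - 1)) (Ioc 0 1) := by
      rw [← intervalIntegrable_iff_integrableOn_Ioc_of_le zero_le_one]
      exact intervalIntegral.intervalIntegrable_rpow' (by linarith)
    refine h.congr_fun (fun t ht => ?_) measurableSet_Ioc
    simp only
    rw [min_eq_left (pow_le_one₀ ht.1.le ht.2), ← Real.rpow_natCast, ← Real.rpow_add ht.1]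
    ring_nf
  · refine (integrableOn_Ioi_rpow_of_lt (a := -s - 1) (by linarith) zero_lt_one).congr_fun
      (fun t ht => ?_) measurableSet_Ioi
    simp only
    rw [min_eq_right (one_le_pow₀ (le_of_lt ht)), one_mul]

lemma norm_exp_sub_one_le_min {z : ℂ} (hz : z.re ≤ 0) :
    ‖Complex.exp z - 1‖ ≤ 2 * min ‖z‖ 1 := by
  rcases le_total ‖z‖ 1 with h | h
  · rw [min_eq_left h]
    exact Complex.norm_exp_sub_one_le h
  · rw [min_eq_right h]
    have h1 : ‖Complex.exp z‖ ≤ 1 := by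
      rw [Complex.norm_exp]
      exact Real.exp_le_one_iff.2 hz
    calc _ ≤ ‖Complex.exp z‖ + ‖(1 : ℂ)‖ := norm_sub_le _ _
      _ ≤ _ := by rw [norm_one]; linarith

lemma norm_exp_neg_mul_sub_one_mul_rpow_le {r : ℂ} {C : ℝ} (hr : 0 ≤ r.re) (hr' : ‖r‖ ≤ C)
    (hC : 1 ≤ C) (s : ℝ) {t : ℝ} (ht : 0 < t) :
    ‖(Complex.exp (-r * t) - 1) * ((t ^ (-s - 1) : ℝ) : ℂ)‖
      ≤ 2 * C * (min (t ^ 1) 1 * t ^ (-s - 1)) := by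
  rw [norm_mul, Complex.norm_real, Real.norm_of_nonneg (by positivity), ← mul_assoc]
  gcongr
  refine (norm_exp_sub_one_le_min ?_).trans ?_
  · simp only [neg_mul, Complex.neg_re, Complex.re_mul_ofReal]
    nlinarith
  · rw [mul_assoc, pow_one, norm_mul, norm_neg, Complex.norm_real, Real.norm_of_nonneg ht.le,
      mul_min_of_nonneg t 1 (by linarith : 0 ≤ C), mul_one]
    gcongr

lemma integrableOn_exp_sub_one_mul_rpow {s : ℝ} (hs : 0 < s) (hs1 : s < 1) {r : ℂ}
    (hr : 0 ≤ r.re) :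
    IntegrableOn (fun t : ℝ => (Complex.exp (-r * t) - 1) * ((t ^ (-s - 1) : ℝ) : ℂ)) (Ioi 0) := by
  have h := (integrableOn_min_pow_mul_rpow (k := 1) hs (by simpa using hs1)).const_mul
    (2 * max ‖r‖ 1)
  refine Integrable.mono' h (by fun_prop) ?_
  filter_upwards [ae_restrict_mem measurableSet_Ioi] with t ht
  exact norm_exp_neg_mul_sub_one_mul_rpow_le hr (le_max_left _ _) (le_max_right _ _) s ht

lemma integral_exp_sub_one_mul_rpow_of_re_pos {s : ℝ} (hs : 0 < s) (hs1 : s < 1) {r : ℂ}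
    (hr : 0 < r.re) :
    ∫ t : ℝ in Ioi 0, (Complex.exp (-r * t) - 1) * ((t ^ (-s - 1) : ℝ) : ℂ)
      = -(r / s) * ((1 / r) ^ ((1 - s : ℝ) : ℂ) * Complex.Gamma ((1 - s : ℝ) : ℂ)) := by
  have hsC : (s : ℂ) ≠ 0 := by exact_mod_cast hs.ne'
  obtain ⟨hGi, hG⟩ := integral_rpow_mul_cexp_neg_mul_Ioi (sub_pos.2 hs1) hr
  rw [show 1 - s - 1 = -s by ring] at hGi hG
  have key : ∀ t : ℝ, -r * Complex.exp (-r * t) * (((t ^ (-s) / (-s) : ℝ)) : ℂ)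
      = (r / s) * (((t ^ (-s) : ℝ) : ℂ) * Complex.exp (-r * t)) := by
    intro t
    push_cast
    field_simp
  have hparts := integral_Ioi_mul_deriv_eq_deriv_mul (a := (0 : ℝ)) (a' := (0 : ℂ)) (b' := (0 : ℂ))
    (u := fun t : ℝ => Complex.exp (-r * t) - 1)
    (u' := fun t : ℝ => -r * Complex.exp (-r * t))
    (v := fun t : ℝ => ((t ^ (-s) / (-s) : ℝ) : ℂ))
    (v' := fun t : ℝ => ((t ^ (-s - 1) : ℝ) : ℂ)) ?_ ?_ ?_ ?_ ?_ ?_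
  · rw [hparts]
    simp only [key]
    rw [integral_const_mul, hG]
    ring
  · intro t _
    have h1 : HasDerivAt (fun t : ℝ => -r * (t : ℂ)) (-r * 1) t :=
      (Complex.ofRealCLM.hasDerivAt (x := t)).const_mul (-r)
    exact (h1.cexp.sub_const 1).congr_deriv (by ring)
  · intro t ht
    have h1 := (Real.hasDerivAt_rpow_const (x := t) (p := -s) (Or.inl (ne_of_gt ht))).div_const (-s)
    refine h1.ofReal_comp.congr_deriv ?_
    rw [mul_div_cancel_left₀ _ (neg_ne_zero.2 hs.ne')]
  · exact integrableOn_exp_sub_one_mul_rpow hs hs1 hr.le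
  · exact IntegrableOn.congr_fun (Integrable.const_mul hGi (r / s)) (fun t _ => (key t).symm)
      measurableSet_Ioi
  · have hlim : Tendsto (fun t : ℝ => 2 * max ‖r‖ 1 / s * t ^ (1 - s)) (𝓝[>] 0) (𝓝 0) := by
      have : ContinuousAt (fun t : ℝ => 2 * max ‖r‖ 1 / s * t ^ (1 - s)) 0 :=
        (Real.continuousAt_rpow_const _ _ (Or.inr (by linarith))).const_mul _
      have h2 := this.tendsto
      rw [Real.zero_rpow (by linarith), mul_zero] at h2
      exact h2.mono_left nhdsWithin_le_nhds
    refine squeeze_zero_norm' ?_ hlim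
    filter_upwards [self_mem_nhdsWithin] with t ht
    have ht : 0 < t := ht
    have h1 := norm_exp_sub_one_le_min (z := -r * t) (by
      simp only [neg_mul, Complex.neg_re, Complex.re_mul_ofReal]; nlinarith)
    have h2 : min ‖-r * (t : ℂ)‖ 1 ≤ max ‖r‖ 1 * t := by
      refine (min_le_left _ _).trans ?_
      rw [norm_mul, norm_neg, Complex.norm_real, Real.norm_of_nonneg ht.le]
      gcongr
      exact le_max_left _ _
    rw [Pi.mul_apply, norm_mul, Complex.norm_real, norm_div, norm_neg,
      Real.norm_of_nonneg (by positivity), Real.norm_of_nonneg hs.le,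
      show (1 - s) = 1 + -s by ring, Real.rpow_add ht, Real.rpow_one]
    calc _ ≤ (2 * (max ‖r‖ 1 * t)) * (t ^ (-s) / s) := by gcongr; linarith
      _ = _ := by ring
  · have hlim : Tendsto (fun t : ℝ => 2 / s * t ^ (-s)) atTop (𝓝 0) := by
      simpa using (tendsto_rpow_neg_atTop hs).const_mul (2 / s)
    refine squeeze_zero_norm' ?_ hlim
    filter_upwards [eventually_gt_atTop 0] with t ht
    have h1 := norm_exp_sub_one_le_min (z := -r * t) (by
      simp only [neg_mul, Complex.neg_re, Complex.re_mul_ofReal]; nlinarith)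
    have h2 : min ‖-r * (t : ℂ)‖ 1 ≤ 1 := min_le_right _ _
    rw [Pi.mul_apply, norm_mul, Complex.norm_real, norm_div, norm_neg,
      Real.norm_of_nonneg (by positivity), Real.norm_of_nonneg hs.le]
    calc _ ≤ 2 * (t ^ (-s) / s) := by gcongr; linarith
      _ = _ := by ring

lemma integral_exp_I_sub_one_mul_rpow {s : ℝ} (hs : 0 < s) (hs1 : s < 1) :
    ∫ t : ℝ in Ioi 0, (Complex.exp (t * Complex.I) - 1) * ((t ^ (-s - 1) : ℝ) : ℂ)
      = ((-(Real.Gamma (1 - s) / s) : ℝ) : ℂ) *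
        Complex.exp ((-(Real.pi * s / 2) : ℝ) * Complex.I) := by
  set r : ℝ → ℂ := fun ε => ε - Complex.I with hr
  have hrc : Tendsto r (𝓝[>] 0) (𝓝 (-Complex.I)) := by
    have : ContinuousAt r 0 := by fun_prop
    have h := this.tendsto
    simp only [hr, Complex.ofReal_zero, zero_sub] at h
    exact h.mono_left nhdsWithin_le_nhds
  have h1 : Tendsto (fun ε => ∫ t : ℝ in Ioi 0,
      (Complex.exp (-r ε * t) - 1) * ((t ^ (-s - 1) : ℝ) : ℂ)) (𝓝[>] 0)
      (𝓝 (∫ t : ℝ in Ioi 0, (Complex.exp (t * Complex.I) - 1) * ((t ^ (-s - 1) : ℝ) : ℂ))) := by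
    refine tendsto_integral_filter_of_dominated_convergence _ ?_ ?_
      ((integrableOn_min_pow_mul_rpow (k := 1) hs (by simpa using hs1)).const_mul (2 * 2)) ?_
    · exact Eventually.of_forall fun ε => by fun_prop
    · filter_upwards [Ioo_mem_nhdsGT (zero_lt_one' ℝ)] with ε hε
      filter_upwards [ae_restrict_mem measurableSet_Ioi] with t ht
      refine norm_exp_neg_mul_sub_one_mul_rpow_le ?_ ?_ (by norm_num) s ht
      · simpa [hr] using hε.1.le
      · refine (norm_sub_le _ _).trans ?_
        rw [Complex.norm_real, Complex.norm_I, Real.norm_of_nonneg hε.1.le]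
        linarith [hε.2]
    · refine Eventually.of_forall fun t => ?_
      have h : Tendsto (fun ε => (Complex.exp (-r ε * t) - 1) * ((t ^ (-s - 1) : ℝ) : ℂ)) (𝓝[>] 0)
          (𝓝 ((Complex.exp (-(-Complex.I) * t) - 1) * ((t ^ (-s - 1) : ℝ) : ℂ))) :=
        (((hrc.neg.mul_const _).cexp).sub_const 1).mul_const _
      simpa only [neg_neg, mul_comm Complex.I] using h
  have h2 : Tendsto (fun ε => ∫ t : ℝ in Ioi 0,
      (Complex.exp (-r ε * t) - 1) * ((t ^ (-s - 1) : ℝ) : ℂ)) (𝓝[>] 0)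
      (𝓝 (-(-Complex.I / s) * (Complex.I ^ ((1 - s : ℝ) : ℂ) *
        Complex.Gamma ((1 - s : ℝ) : ℂ)))) := by
    have hinv : Tendsto (fun ε => 1 / r ε) (𝓝[>] 0) (𝓝 Complex.I) := by
      simpa using hrc.inv₀ (by simp)
    have h : Tendsto (fun ε => -(r ε / s) *
        ((1 / r ε) ^ ((1 - s : ℝ) : ℂ) * Complex.Gamma ((1 - s : ℝ) : ℂ)))
        (𝓝[>] 0) (𝓝 (-(-Complex.I / s) * (Complex.I ^ ((1 - s : ℝ) : ℂ) *
          Complex.Gamma ((1 - s : ℝ) : ℂ)))) := by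
      refine (hrc.div_const _).neg.mul (Tendsto.mul_const _ ?_)
      exact (continuousAt_cpow_const (by simp [Complex.slitPlane])).tendsto.comp hinv
    refine h.congr' ?_
    filter_upwards [self_mem_nhdsWithin] with ε hε
    rw [integral_exp_sub_one_mul_rpow_of_re_pos hs hs1]
    simpa [hr] using hε
  rw [tendsto_nhds_unique h1 h2, Complex.Gamma_ofReal,
    Complex.cpow_def_of_ne_zero Complex.I_ne_zero, Complex.log_I]
  have h3 : Complex.exp (Real.pi / 2 * Complex.I * ((1 - s : ℝ) : ℂ))
      = Complex.I * Complex.exp ((-(Real.pi * s / 2) : ℝ) * Complex.I) := by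
    rw [show (Real.pi / 2 * Complex.I * ((1 - s : ℝ) : ℂ))
        = Real.pi / 2 * Complex.I + (-(Real.pi * s / 2) : ℝ) * Complex.I by push_cast; ring,
      Complex.exp_add, Complex.exp_pi_div_two_mul_I]
  rw [h3]
  push_cast
  linear_combination (Real.Gamma (1 - s) : ℂ) / s *
    Complex.exp (-(Real.pi * s / 2) * Complex.I) * Complex.I_mul_I

/-- The real form of the integrand
`((e^{itx} - 1) / (it)^(s + 1) + (e^{-itx} - 1) / (-it)^(s + 1)) / 2`. -/
noncomputable def cosKernel (s x t : ℝ) : ℝ :=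
  (Real.cos (t * x - Real.pi * (s + 1) / 2) - Real.cos (Real.pi * (s + 1) / 2)) * t ^ (-s - 1)

lemma cosKernel_one_eq_re (s t : ℝ) : cosKernel s 1 t =
    (Complex.exp (-(Real.pi * (s + 1) / 2 : ℝ) * Complex.I) *
      ((Complex.exp (t * Complex.I) - 1) * ((t ^ (-s - 1) : ℝ) : ℂ))).re := by
  rw [cosKernel, ← mul_assoc, Complex.re_mul_ofReal, mul_sub _ _ (1 : ℂ), mul_one (Complex.exp _),
    ← Complex.exp_add, ← add_mul]
  norm_cast
  rw [Complex.sub_re, Complex.exp_ofReal_mul_I_re, Complex.exp_ofReal_mul_I_re, Real.cos_neg,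
    mul_one, neg_add_eq_sub]

lemma cosKernel_neg_one_eq_re (s t : ℝ) : cosKernel s (-1) t =
    (Complex.exp ((Real.pi * (s + 1) / 2 : ℝ) * Complex.I) *
      ((Complex.exp (t * Complex.I) - 1) * ((t ^ (-s - 1) : ℝ) : ℂ))).re := by
  rw [cosKernel, ← mul_assoc, Complex.re_mul_ofReal, mul_sub _ _ (1 : ℂ), mul_one (Complex.exp _),
    ← Complex.exp_add, ← add_mul]
  simp only [mul_neg, mul_one]
  norm_cast
  rw [Complex.sub_re, Complex.exp_ofReal_mul_I_re, Complex.exp_ofReal_mul_I_re,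
    ← Real.cos_neg (-t - _), show -(-t - Real.pi * (s + 1) / 2)
      = Real.pi * (s + 1) / 2 + t by ring]

lemma integrableOn_exp_I_sub_one_mul_rpow {s : ℝ} (hs : 0 < s) (hs1 : s < 1) :
    IntegrableOn (fun t : ℝ => (Complex.exp (t * Complex.I) - 1) * ((t ^ (-s - 1) : ℝ) : ℂ))
      (Ioi 0) := by
  simpa [mul_comm Complex.I] using
    integrableOn_exp_sub_one_mul_rpow hs hs1 (r := -Complex.I) (by simp)

lemma integral_cosKernel_one_of_lt {s : ℝ} (hs : 0 < s) (hs1 : s < 1) :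
    IntegrableOn (cosKernel s 1) (Ioi 0) ∧
      ∫ t in Ioi 0, cosKernel s 1 t = Real.pi / Real.Gamma (s + 1) := by
  have hi := (integrableOn_exp_I_sub_one_mul_rpow hs hs1).const_mul
    (Complex.exp (-(Real.pi * (s + 1) / 2 : ℝ) * Complex.I))
  rw [funext (cosKernel_one_eq_re s)]
  refine ⟨hi.re, ?_⟩
  have h := integral_re hi
  simp only [RCLike.re_eq_complex_re] at h
  rw [h, integral_const_mul, integral_exp_I_sub_one_mul_rpow hs hs1, mul_left_comm,
    Complex.re_ofReal_mul, ← Complex.exp_add, ← add_mul]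
  norm_cast
  rw [Complex.exp_ofReal_mul_I_re,
    show -(Real.pi * (s + 1) / 2) + -(Real.pi * s / 2) = -(Real.pi * s + Real.pi / 2) by ring,
    Real.cos_neg, Real.cos_add_pi_div_two, Real.Gamma_add_one hs.ne']
  have hsin : 0 < Real.sin (Real.pi * s) :=
    Real.sin_pos_of_pos_of_lt_pi (by positivity) (by nlinarith [Real.pi_pos])
  have hG := Real.Gamma_pos_of_pos hs
  have hrefl := Real.Gamma_mul_Gamma_one_sub s
  rw [eq_div_iff hsin.ne'] at hrefl
  rw [neg_mul_neg, div_mul_eq_mul_div, div_eq_div_iff hs.ne' (by positivity)]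
  linear_combination s * hrefl

lemma integral_cosKernel_neg_one_of_lt {s : ℝ} (hs : 0 < s) (hs1 : s < 1) :
    IntegrableOn (cosKernel s (-1)) (Ioi 0) ∧ ∫ t in Ioi 0, cosKernel s (-1) t = 0 := by
  have hi := (integrableOn_exp_I_sub_one_mul_rpow hs hs1).const_mul
    (Complex.exp ((Real.pi * (s + 1) / 2 : ℝ) * Complex.I))
  rw [funext (cosKernel_neg_one_eq_re s)]
  refine ⟨hi.re, ?_⟩
  have h := integral_re hi
  simp only [RCLike.re_eq_complex_re] at h
  rw [h, integral_const_mul, integral_exp_I_sub_one_mul_rpow hs hs1, mul_left_comm,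
    Complex.re_ofReal_mul, ← Complex.exp_add, ← add_mul]
  norm_cast
  rw [Complex.exp_ofReal_mul_I_re,
    show Real.pi * (s + 1) / 2 + -(Real.pi * s / 2) = Real.pi / 2 by ring, Real.cos_pi_div_two,
    mul_zero]

lemma cosKernel_one_add_neg_one (s t : ℝ) : cosKernel s 1 t + cosKernel s (-1) t =
    2 * Real.cos (Real.pi * (s + 1) / 2) * ((Real.cos t - 1) * t ^ (-s - 1)) := by
  simp only [cosKernel, mul_one, mul_neg, Real.cos_sub, Real.cos_neg, Real.sin_neg]
  ring

lemma cosKernel_one_neg (x t : ℝ) : cosKernel 1 (-x) t = cosKernel 1 x t := by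
  rw [cosKernel, cosKernel, show Real.pi * (1 + 1) / 2 = Real.pi by ring]
  simp [Real.cos_sub]

lemma abs_cos_sub_one_mul_rpow_le {s t : ℝ} (ht : 0 < t) :
    |(Real.cos t - 1) * t ^ (-s - 1)| ≤ 2 * (min (t ^ 2) 1 * t ^ (-s - 1)) := by
  rw [abs_mul, abs_of_nonneg (Real.rpow_nonneg ht.le _), ← mul_assoc, abs_sub_comm,
    abs_of_nonneg (by linarith [Real.cos_le_one t])]
  gcongr
  rw [mul_min_of_nonneg _ _ zero_le_two]
  refine le_min ?_ (by linarith [Real.neg_one_le_cos t])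
  nlinarith [Real.one_sub_sq_div_two_le_cos (x := t)]

lemma integrableOn_cos_sub_one_mul_rpow {s : ℝ} (hs : 0 < s) (hs2 : s < 2) :
    IntegrableOn (fun t : ℝ => (Real.cos t - 1) * t ^ (-s - 1)) (Ioi 0) := by
  refine Integrable.mono' ((integrableOn_min_pow_mul_rpow (k := 2) hs
    (by simpa using hs2)).const_mul 2) (by fun_prop) ?_
  filter_upwards [ae_restrict_mem measurableSet_Ioi] with t ht
  exact abs_cos_sub_one_mul_rpow_le ht

lemma integral_cosKernel_one_one :
    IntegrableOn (cosKernel 1 1) (Ioi 0) ∧ ∫ t in Ioi 0, cosKernel 1 1 t = Real.pi / 2 := by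
  have hadd : ∀ t, cosKernel 1 1 t = -((Real.cos t - 1) * t ^ (-1 - 1 : ℝ)) := by
    intro t
    have h := cosKernel_one_add_neg_one 1 t
    rw [cosKernel_one_neg, show Real.pi * (1 + 1) / 2 = Real.pi by ring, Real.cos_pi] at h
    linarith
  have hi := integrableOn_cos_sub_one_mul_rpow one_pos one_lt_two
  have hlim : Tendsto (fun s : ℝ => ∫ t in Ioi (0 : ℝ), (Real.cos t - 1) * t ^ (-s - 1)) (𝓝[<] 1)
      (𝓝 (∫ t in Ioi (0 : ℝ), (Real.cos t - 1) * t ^ (-1 - 1 : ℝ))) := by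
    refine tendsto_integral_filter_of_dominated_convergence
      (fun t => 2 * (min (t ^ 2) 1 * t ^ (-1 - 1 : ℝ) + min (t ^ 2) 1 * t ^ (-(1 / 2) - 1 : ℝ)))
      (Eventually.of_forall fun s => by fun_prop) ?_ ?_ ?_
    · filter_upwards [Ioo_mem_nhdsLT (show (1 / 2 : ℝ) < 1 by norm_num)] with s hs
      filter_upwards [ae_restrict_mem measurableSet_Ioi] with t ht
      have ht : 0 < t := ht
      refine (abs_cos_sub_one_mul_rpow_le ht).trans ?_
      rw [← mul_add]
      gcongr
      rcases le_total t 1 with h | h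
      · refine le_add_of_le_of_nonneg ?_ (by positivity)
        exact Real.rpow_le_rpow_of_exponent_ge ht h (by linarith [hs.2])
      · refine le_add_of_nonneg_of_le (by positivity) ?_
        exact Real.rpow_le_rpow_of_exponent_le h (by linarith [hs.1])
    · exact ((integrableOn_min_pow_mul_rpow (k := 2) one_pos (by norm_num)).add
        (integrableOn_min_pow_mul_rpow (k := 2) (by norm_num) (by norm_num))).const_mul 2
    · filter_upwards [ae_restrict_mem measurableSet_Ioi] with t ht
      have ht : 0 < t := ht
      have : ContinuousAt (fun s : ℝ => (Real.cos t - 1) * t ^ (-s - 1)) 1 := by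
        refine continuousAt_const.mul ?_
        exact (Real.continuousAt_const_rpow ht.ne').comp (by fun_prop)
      exact this.tendsto.mono_left nhdsWithin_le_nhds
  have hval : ∀ᶠ s : ℝ in 𝓝[<] 1, 2 * Real.cos (Real.pi * (s + 1) / 2) *
      ∫ t in Ioi (0 : ℝ), (Real.cos t - 1) * t ^ (-s - 1) = Real.pi / Real.Gamma (s + 1) := by
    filter_upwards [Ioo_mem_nhdsLT (zero_lt_one' ℝ)] with s hs
    obtain ⟨h1, h1'⟩ := integral_cosKernel_one_of_lt hs.1 hs.2
    obtain ⟨h2, h2'⟩ := integral_cosKernel_neg_one_of_lt hs.1 hs.2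
    rw [← integral_const_mul]
    simp only [← cosKernel_one_add_neg_one]
    rw [integral_add h1 h2, h1', h2', add_zero]
  have hcos : Tendsto (fun s : ℝ => 2 * Real.cos (Real.pi * (s + 1) / 2)) (𝓝[<] 1) (𝓝 (-2)) := by
    have : ContinuousAt (fun s : ℝ => 2 * Real.cos (Real.pi * (s + 1) / 2)) 1 := by fun_prop
    have h := this.tendsto
    simp only [show Real.pi * (1 + 1) / 2 = Real.pi by ring, Real.cos_pi, mul_neg, mul_one] at h
    exact h.mono_left nhdsWithin_le_nhds
  have hGamma : Tendsto (fun s : ℝ => Real.pi / Real.Gamma (s + 1)) (𝓝[<] 1) (𝓝 Real.pi) := by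
    have hc : ContinuousAt Real.Gamma (1 + 1) :=
      (Real.differentiableAt_Gamma fun m => by linarith [m.cast_nonneg (α := ℝ)]).continuousAt
    have : ContinuousAt (fun s : ℝ => Real.pi / Real.Gamma (s + 1)) 1 := by
      refine continuousAt_const.div
        (ContinuousAt.comp (f := fun s : ℝ => s + 1) hc (by fun_prop)) ?_
      exact (Real.Gamma_pos_of_pos (by norm_num)).ne'
    have h := this.tendsto
    rw [show (1 : ℝ) + 1 = 2 by norm_num, Real.Gamma_two, div_one] at h
    exact h.mono_left nhdsWithin_le_nhds
  have heq := tendsto_nhds_unique (hcos.mul hlim) (hGamma.congr' (hval.mono fun s hs => hs.symm))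
  rw [funext hadd]
  refine ⟨hi.neg, ?_⟩
  rw [integral_neg, ← heq]
  ring

lemma integrableOn_cosKernel_one {s : ℝ} (hs : 0 < s) (hs1 : s ≤ 1) :
    IntegrableOn (cosKernel s 1) (Ioi 0) ∧ IntegrableOn (cosKernel s (-1)) (Ioi 0) := by
  rcases hs1.lt_or_eq with h | rfl
  · exact ⟨(integral_cosKernel_one_of_lt hs h).1, (integral_cosKernel_neg_one_of_lt hs h).1⟩
  · rw [funext (cosKernel_one_neg 1)]
    exact ⟨integral_cosKernel_one_one.1, integral_cosKernel_one_one.1⟩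

lemma cosKernel_mul {a : ℝ} (ha : 0 < a) (s x : ℝ) {t : ℝ} (ht : 0 < t) :
    cosKernel s (a * x) t = a ^ (s + 1) * cosKernel s x (a * t) := by
  rw [cosKernel, cosKernel, Real.mul_rpow ha.le ht.le, show (-s - 1) = -(s + 1) by ring,
    Real.rpow_neg ha.le]
  have := Real.rpow_pos_of_pos ha (s + 1)
  field_simp

lemma integrableOn_cosKernel_mul {a : ℝ} (ha : 0 < a) {s x : ℝ}
    (h : IntegrableOn (cosKernel s x) (Ioi 0)) :
    IntegrableOn (cosKernel s (a * x)) (Ioi 0) := by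
  have h1 := (integrableOn_Ioi_comp_mul_left_iff (cosKernel s x) 0 ha).2 (by simpa using h)
  exact IntegrableOn.congr_fun (h1.const_mul (a ^ (s + 1)))
    (fun t ht => (cosKernel_mul ha s x ht).symm) measurableSet_Ioi

lemma integral_cosKernel_mul {a : ℝ} (ha : 0 < a) (s x : ℝ) :
    ∫ t in Ioi 0, cosKernel s (a * x) t = a ^ s * ∫ t in Ioi 0, cosKernel s x t := by
  rw [setIntegral_congr_fun measurableSet_Ioi (fun t ht => cosKernel_mul ha s x ht),
    integral_const_mul, integral_comp_mul_left_Ioi _ _ ha, Real.rpow_add_one ha.ne', mul_zero,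
    smul_eq_mul]
  field_simp

lemma integral_norm_cosKernel_mul {a : ℝ} (ha : 0 < a) (s x : ℝ) :
    ∫ t in Ioi 0, ‖cosKernel s (a * x) t‖ = a ^ s * ∫ t in Ioi 0, ‖cosKernel s x t‖ := by
  have h : ∀ t ∈ Ioi (0 : ℝ), ‖cosKernel s (a * x) t‖ = a ^ (s + 1) * ‖cosKernel s x (a * t)‖ := by
    intro t ht
    rw [cosKernel_mul ha s x ht, norm_mul, Real.norm_of_nonneg (by positivity)]
  rw [setIntegral_congr_fun measurableSet_Ioi h, integral_const_mul,
    integral_comp_mul_left_Ioi (fun t => ‖cosKernel s x t‖) _ ha, Real.rpow_add_one ha.ne',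
    mul_zero, smul_eq_mul]
  field_simp

lemma cosKernel_zero (s t : ℝ) : cosKernel s 0 t = 0 := by
  simp [cosKernel]

lemma integrableOn_cosKernel {s : ℝ} (hs : 0 < s) (hs1 : s ≤ 1) (x : ℝ) :
    IntegrableOn (cosKernel s x) (Ioi 0) := by
  obtain ⟨h1, h2⟩ := integrableOn_cosKernel_one hs hs1
  rcases lt_trichotomy x 0 with hx | rfl | hx
  · simpa using integrableOn_cosKernel_mul (neg_pos.2 hx) h2
  · rw [funext (cosKernel_zero s)]
    exact integrableOn_zero
  · simpa using integrableOn_cosKernel_mul hx h1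

lemma exists_integral_norm_cosKernel_le {s : ℝ} (hs : 0 < s) :
    ∃ C, ∀ x, ∫ t in Ioi 0, ‖cosKernel s x t‖ ≤ C * |x| ^ s := by
  refine ⟨max (∫ t in Ioi 0, ‖cosKernel s 1 t‖) (∫ t in Ioi 0, ‖cosKernel s (-1) t‖), fun x => ?_⟩
  rw [mul_comm]
  rcases lt_trichotomy x 0 with hx | rfl | hx
  · have h := integral_norm_cosKernel_mul (neg_pos.2 hx) s (-1)
    rw [neg_mul_neg, mul_one] at h
    rw [h, abs_of_neg hx]
    exact mul_le_mul_of_nonneg_left (le_max_right _ _) (Real.rpow_nonneg (neg_pos.2 hx).le _)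
  · simp [cosKernel_zero, Real.zero_rpow hs.ne']
  · have h := integral_norm_cosKernel_mul hx s 1
    rw [mul_one] at h
    rw [h, abs_of_pos hx]
    exact mul_le_mul_of_nonneg_left (le_max_left _ _) (Real.rpow_nonneg hx.le _)

lemma integral_cosKernel {s : ℝ} (hs : 0 < s) (hs1 : s ≤ 1) (x : ℝ) :
    Real.Gamma (s + 1) / Real.pi * ∫ t in Ioi 0, cosKernel s x t
      = posPow x s - if s = 1 then x / 2 else 0 := by
  have hG := Real.Gamma_pos_of_pos (show 0 < s + 1 by linarith)
  have hpi := Real.pi_pos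
  have hneg := integral_cosKernel_mul (a := -x) (s := s) (x := -1)
  have hpos := integral_cosKernel_mul (a := x) (s := s) (x := 1)
  rw [neg_mul_neg, mul_one] at hneg
  rw [mul_one] at hpos
  rcases lt_trichotomy x 0 with hx | rfl | hx
  · rw [hneg (neg_pos.2 hx), posPow, if_neg hx.not_gt]
    split_ifs with h
    · rw [h, funext (cosKernel_one_neg 1), integral_cosKernel_one_one.2,
        show (1 : ℝ) + 1 = 2 by norm_num, Real.Gamma_two, Real.rpow_one]
      field_simp
      ring
    · rw [(integral_cosKernel_neg_one_of_lt hs (lt_of_le_of_ne hs1 h)).2]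
      simp
  · simp [cosKernel_zero, posPow]
  · rw [hpos hx, posPow, if_pos hx]
    split_ifs with h
    · rw [h, integral_cosKernel_one_one.2, show (1 : ℝ) + 1 = 2 by norm_num, Real.Gamma_two,
        Real.rpow_one]
      field_simp
      ring
    · rw [(integral_cosKernel_one_of_lt hs (lt_of_le_of_ne hs1 h)).2]
      field_simp
      simp

lemma inv_I_mul_cpow {t : ℝ} (ht : 0 < t) (c : ℝ) :
    ((Complex.I * t) ^ (c : ℂ))⁻¹ =
      Complex.exp ((-(Real.pi * c / 2) : ℝ) * Complex.I) * ((t ^ (-c) : ℝ) : ℂ) := by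
  have h0 : Complex.I * (t : ℂ) ≠ 0 := mul_ne_zero Complex.I_ne_zero (by exact_mod_cast ht.ne')
  rw [← Complex.cpow_neg, Complex.cpow_def_of_ne_zero h0,
    Complex.log_mul_ofReal t ht _ Complex.I_ne_zero, Complex.log_I, Real.rpow_def_of_pos ht,
    Complex.ofReal_exp, ← Complex.exp_add]
  congr 1
  push_cast
  ring

lemma inv_neg_I_mul_cpow {t : ℝ} (ht : 0 < t) (c : ℝ) :
    ((-(Complex.I * t)) ^ (c : ℂ))⁻¹ =
      Complex.exp ((Real.pi * c / 2 : ℝ) * Complex.I) * ((t ^ (-c) : ℝ) : ℂ) := by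
  have h0 : -Complex.I * (t : ℂ) ≠ 0 :=
    mul_ne_zero (neg_ne_zero.2 Complex.I_ne_zero) (by exact_mod_cast ht.ne')
  rw [← neg_mul, ← Complex.cpow_neg, Complex.cpow_def_of_ne_zero h0,
    Complex.log_mul_ofReal t ht _ (neg_ne_zero.2 Complex.I_ne_zero), Complex.log_neg_I,
    Real.rpow_def_of_pos ht, Complex.ofReal_exp, ← Complex.exp_add]
  congr 1
  push_cast
  ring

lemma exp_sub_one_div_cpow_add_eq_cosKernel {t : ℝ} (ht : 0 < t) (s x : ℝ) :
    (Complex.exp (t * x * Complex.I) - 1) / (Complex.I * t) ^ ((s + 1 : ℝ) : ℂ)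
      + (Complex.exp (-(t * x * Complex.I)) - 1) / (-(Complex.I * t)) ^ ((s + 1 : ℝ) : ℂ)
      = 2 * (cosKernel s x t : ℂ) := by
  rw [div_eq_mul_inv, div_eq_mul_inv, inv_I_mul_cpow ht, inv_neg_I_mul_cpow ht, cosKernel,
    Complex.ofReal_mul, Complex.ofReal_sub, Complex.ofReal_cos, Complex.ofReal_cos, Complex.cos,
    Complex.cos, show -s - 1 = -(s + 1) by ring, ← mul_assoc, ← mul_assoc, ← mul_assoc,
    sub_mul _ _ (Complex.exp _), sub_mul _ _ (Complex.exp _), ← Complex.exp_add,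
    ← Complex.exp_add, ← add_mul]
  congr 1
  push_cast
  rw [show (t : ℂ) * x * Complex.I + -(Real.pi * (s + 1) / 2) * Complex.I
    = (t * x - Real.pi * (s + 1) / 2) * Complex.I by ring,
    show -((t : ℂ) * x * Complex.I) + (Real.pi * (s + 1) / 2) * Complex.I
    = -(t * x - Real.pi * (s + 1) / 2) * Complex.I by ring]
  ring

section CharacteristicFunction

variable {Ω : Type*} [MeasurableSpace Ω] {μ : Measure Ω} {X : Ω → ℝ} {p : ℝ}

lemma cf_eq_charFun (hX : Measurable X) : cf μ X = charFun (μ.map X) := by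
  ext t
  rw [cf, charFun_apply_real, integral_map hX.aemeasurable (by fun_prop)]
  congr with ω
  ring_nf

lemma memLp_of_integrable_abs_rpow [IsFiniteMeasure μ] (hp : 0 < p) (hX : Measurable X)
    (hmom : Integrable (fun ω => |X ω| ^ p) μ) {n : ℕ} (hn : (n : ℝ) ≤ p) : MemLp X n μ := by
  have h : MemLp X (ENNReal.ofReal p) μ := by
    rw [← integrable_norm_rpow_iff hX.aestronglyMeasurable (by simpa using hp) (by simp),
      ENNReal.toReal_ofReal hp.le]
    exact hmom
  refine h.mono_exponent ?_
  rw [← ENNReal.ofReal_natCast]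
  exact ENNReal.ofReal_le_ofReal hn

lemma integrable_pow_mul_exp [IsFiniteMeasure μ] (hX : Measurable X) {n : ℕ}
    (h : MemLp X n μ) (t : ℝ) :
    Integrable (fun ω => (X ω : ℂ) ^ n * Complex.exp (t * X ω * Complex.I)) μ := by
  refine (integrable_norm_iff (by fun_prop)).1 ?_
  refine h.integrable_norm_pow'.congr (Eventually.of_forall fun ω => ?_)
  simp only
  rw [norm_mul, norm_pow, Complex.norm_real, ← Complex.ofReal_mul, Complex.norm_exp_ofReal_mul_I,
    mul_one]

lemma iteratedDeriv_cf [IsFiniteMeasure μ] (hX : Measurable X) {n : ℕ} (h : MemLp X n μ) (t : ℝ) :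
    iteratedDeriv n (cf μ X) t =
      Complex.I ^ n * ∫ ω, (X ω : ℂ) ^ n * Complex.exp (t * X ω * Complex.I) ∂μ := by
  have h' : MemLp id n (μ.map X) :=
    (memLp_map_measure_iff (by fun_prop) hX.aemeasurable).2 h
  rw [cf_eq_charFun hX, iteratedDeriv_charFun h', integral_map hX.aemeasurable (by fun_prop)]

lemma iteratedDeriv_cf_sub_div_cpow_add [IsFiniteMeasure μ] (hX : Measurable X) {n : ℕ}
    (h : MemLp X n μ) (u s : ℝ) {t : ℝ} (ht : 0 < t) :
    (iteratedDeriv n (cf μ X) (u + t) - iteratedDeriv n (cf μ X) u)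
        / (Complex.I * t) ^ ((s + 1 : ℝ) : ℂ)
      + (iteratedDeriv n (cf μ X) (u - t) - iteratedDeriv n (cf μ X) u)
        / (-(Complex.I * t)) ^ ((s + 1 : ℝ) : ℂ)
      = 2 * Complex.I ^ n * ∫ ω, (X ω : ℂ) ^ n * Complex.exp (u * X ω * Complex.I) *
          (cosKernel s (X ω) t : ℂ) ∂μ := by
  have hi := fun v => integrable_pow_mul_exp hX h v
  have hd : ∀ (v : ℝ) (c : ℂ), Integrable (fun ω =>
      ((X ω : ℂ) ^ n * Complex.exp (v * X ω * Complex.I) -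
        (X ω : ℂ) ^ n * Complex.exp (u * X ω * Complex.I)) / c) μ :=
    fun v c => ((hi v).sub (hi u)).div_const c
  simp only [iteratedDeriv_cf hX h]
  rw [← mul_sub, ← mul_sub, ← integral_sub (hi _) (hi _), ← integral_sub (hi _) (hi _),
    mul_div_assoc, mul_div_assoc, ← mul_add, ← integral_div, ← integral_div,
    ← integral_add (hd _ _) (hd _ _),
    mul_comm 2, mul_assoc, ← integral_const_mul (2 : ℂ)]
  congr 1
  apply integral_congr_ae
  refine Eventually.of_forall fun ω => ?_
  beta_reduce
  have hk := exp_sub_one_div_cpow_add_eq_cosKernel ht s (X ω)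
  rw [mul_left_comm, ← hk]
  push_cast
  rw [add_mul, add_mul, Complex.exp_add, sub_eq_add_neg (u : ℂ), add_mul, add_mul, Complex.exp_add,
    neg_mul, neg_mul]
  ring

lemma integrable_prod_pow_mul_exp_mul_cosKernel [IsFiniteMeasure μ] (hX : Measurable X)
    (u : ℝ) {n : ℕ} {s : ℝ} (hs : 0 < s) (hs1 : s ≤ 1)
    (hmom : Integrable (fun ω => |X ω| ^ (n + s)) μ) :
    Integrable (fun q : Ω × ℝ => (X q.1 : ℂ) ^ n * Complex.exp (u * X q.1 * Complex.I) *
      (cosKernel s (X q.1) q.2 : ℂ)) (μ.prod (volume.restrict (Ioi 0))) := by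
  have hk : Measurable fun q : Ω × ℝ => cosKernel s (X q.1) q.2 := by
    unfold cosKernel
    fun_prop
  have hmeas : Measurable (fun q : Ω × ℝ => (X q.1 : ℂ) ^ n *
      Complex.exp (u * X q.1 * Complex.I) * (cosKernel s (X q.1) q.2 : ℂ)) := by fun_prop
  rw [integrable_prod_iff hmeas.aestronglyMeasurable]
  refine ⟨Eventually.of_forall fun ω =>
    (integrableOn_cosKernel hs hs1 (X ω)).ofReal.const_mul
      ((X ω : ℂ) ^ n * Complex.exp (u * X ω * Complex.I)), ?_⟩
  obtain ⟨C, hC⟩ := exists_integral_norm_cosKernel_le hs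
  refine Integrable.mono' (hmom.const_mul C)
    (hmeas.stronglyMeasurable.norm.integral_prod_right.aestronglyMeasurable)
    (Eventually.of_forall fun ω => ?_)
  have hn : ∀ t : ℝ, ‖(X ω : ℂ) ^ n * Complex.exp (u * X ω * Complex.I) *
      (cosKernel s (X ω) t : ℂ)‖ = |X ω| ^ n * ‖cosKernel s (X ω) t‖ := by
    intro t
    rw [norm_mul, norm_mul, norm_pow, Complex.norm_real, ← Complex.ofReal_mul,
      Complex.norm_exp_ofReal_mul_I, mul_one, Complex.norm_real, Real.norm_eq_abs (X ω)]
  simp only [hn]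
  rw [integral_const_mul, Real.norm_of_nonneg
    (mul_nonneg (by positivity) (integral_nonneg fun t => norm_nonneg _)),
    Real.rpow_add_of_nonneg (abs_nonneg _) n.cast_nonneg hs.le, Real.rpow_natCast]
  calc _ ≤ |X ω| ^ n * (C * |X ω| ^ s) := by gcongr; exact hC _
    _ = _ := by ring

end CharacteristicFunction

lemma posPow_natCast_add (x : ℝ) (n : ℕ) (s : ℝ) : posPow x (n + s) = x ^ n * posPow x s := by
  unfold posPow
  split_ifs with h
  · rw [Real.rpow_add h, Real.rpow_natCast]
  · rw [mul_zero]

lemma natCast_ceil_sub_one_bounds {p : ℝ} (hp : 0 < p) :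
    0 < p - ⌈p - 1⌉₊ ∧ p - ⌈p - 1⌉₊ ≤ 1 := by
  refine ⟨?_, by linarith [Nat.le_ceil (p - 1)]⟩
  rcases le_total (p - 1) 0 with h | h
  · rw [Nat.ceil_eq_zero.2 h]
    simpa using hp
  · linarith [Nat.ceil_lt_add_one h]

lemma exists_pos_natCast_eq_iff {p : ℝ} :
    (∃ n : ℕ, 0 < n ∧ (n : ℝ) = p) ↔ p - ⌈p - 1⌉₊ = 1 := by
  constructor
  · rintro ⟨n, hn, rfl⟩
    obtain ⟨m, rfl⟩ := Nat.exists_eq_succ_of_ne_zero hn.ne'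
    simp
  · intro h
    exact ⟨⌈p - 1⌉₊ + 1, Nat.succ_pos _, by push_cast; linarith⟩

theorem stmt7 {Ω : Type*} [MeasurableSpace Ω] (μ : Measure Ω) [IsProbabilityMeasure μ]
    (p u : ℝ) (hp : 0 < p) (X : Ω → ℝ) (hX : Measurable X)
    (hmom : Integrable (fun ω => |X ω| ^ p) μ)
    (ℓ : ℕ) (hl : ℓ = ⌈p - 1⌉₊) (lam : ℝ) (hlam : lam = p - ℓ) :
    IntegrableOn
      (fun t =>
        (iteratedDeriv ℓ (cf μ X) (u + t) - iteratedDeriv ℓ (cf μ X) u)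
            / (Complex.I * t) ^ ((lam + 1 : ℝ) : ℂ)
          + (iteratedDeriv ℓ (cf μ X) (u - t) - iteratedDeriv ℓ (cf μ X) u)
            / (-(Complex.I * t)) ^ ((lam + 1 : ℝ) : ℂ)) (Ioi 0) volume ∧
    (∫ ω, (posPow (X ω) p : ℂ) * Complex.exp (Complex.I * u * X ω) ∂μ)
      = (if ∃ n : ℕ, 0 < n ∧ (n : ℝ) = p then
          iteratedDeriv (ℓ + 1) (cf μ X) u / (2 * Complex.I ^ ((p : ℝ) : ℂ)) else 0)
        + (Real.Gamma (lam + 1) : ℂ) / (2 * Real.pi * Complex.I ^ ℓ)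
          * ∫ t in Ioi (0:ℝ),
              ((iteratedDeriv ℓ (cf μ X) (u + t) - iteratedDeriv ℓ (cf μ X) u)
                  / (Complex.I * t) ^ ((lam + 1 : ℝ) : ℂ)
                + (iteratedDeriv ℓ (cf μ X) (u - t) - iteratedDeriv ℓ (cf μ X) u)
                  / (-(Complex.I * t)) ^ ((lam + 1 : ℝ) : ℂ)) := by
  obtain ⟨hs, hs1⟩ : 0 < lam ∧ lam ≤ 1 := by
    rw [hlam, hl]
    exact natCast_ceil_sub_one_bounds hp
  have hcond : (∃ n : ℕ, 0 < n ∧ (n : ℝ) = p) ↔ lam = 1 := by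
    rw [hlam, hl]
    exact exists_pos_natCast_eq_iff
  have hpl : p = ℓ + lam := by linarith
  have hL : MemLp X ℓ μ := memLp_of_integrable_abs_rpow hp hX hmom (by linarith)
  have hF := integrable_prod_pow_mul_exp_mul_cosKernel hX u hs hs1 (n := ℓ) (hpl ▸ hmom)
  have hcongr : EqOn _ _ (Ioi (0 : ℝ)) :=
    fun t ht => iteratedDeriv_cf_sub_div_cpow_add hX hL u lam (t := t) ht
  refine ⟨(integrableOn_congr_fun hcongr measurableSet_Ioi).2
    (hF.integral_prod_right.const_mul _), ?_⟩
  rw [setIntegral_congr_fun measurableSet_Ioi hcongr, integral_const_mul,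
    ← integral_integral_swap hF]
  have hinner : ∀ ω, ∫ t in Ioi 0, (X ω : ℂ) ^ ℓ * Complex.exp (u * X ω * Complex.I) *
      (cosKernel lam (X ω) t : ℂ) = (X ω : ℂ) ^ ℓ * Complex.exp (u * X ω * Complex.I) *
        ((∫ t in Ioi 0, cosKernel lam (X ω) t : ℝ) : ℂ) := by
    intro ω
    rw [integral_const_mul, integral_complex_ofReal]
  have hpt : ∀ ω, (posPow (X ω) p : ℂ) * Complex.exp (Complex.I * u * X ω) =
      (Real.Gamma (lam + 1) / Real.pi : ℝ) * ((X ω : ℂ) ^ ℓ *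
        Complex.exp (u * X ω * Complex.I) * ((∫ t in Ioi 0, cosKernel lam (X ω) t : ℝ) : ℂ)) +
      if lam = 1 then 1 / 2 * ((X ω : ℂ) ^ (ℓ + 1) * Complex.exp (u * X ω * Complex.I)) else 0 := by
    intro ω
    have h := congrArg (fun r : ℝ => (r : ℂ)) (integral_cosKernel hs hs1 (X ω))
    rw [hpl, posPow_natCast_add, mul_assoc Complex.I, mul_comm Complex.I]
    split_ifs at h ⊢
    all_goals
      push_cast at h ⊢
      linear_combination (-(X ω : ℂ) ^ ℓ * Complex.exp (u * X ω * Complex.I)) * h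
  have hI : Complex.I ^ ℓ ≠ 0 := pow_ne_zero _ Complex.I_ne_zero
  have hpi : (Real.pi : ℂ) ≠ 0 := by exact_mod_cast Real.pi_ne_zero
  have hFi := hF.integral_prod_left
  simp only [hinner] at hFi ⊢
  simp only [hpt, hcond]
  split_ifs with h1
  · have hL1 : MemLp X (ℓ + 1 : ℕ) μ :=
      memLp_of_integrable_abs_rpow hp hX hmom (by push_cast; linarith)
    rw [integral_add (hFi.const_mul _) ((integrable_pow_mul_exp hX hL1 u).const_mul _),
      integral_const_mul, integral_const_mul, iteratedDeriv_cf hX hL1,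
      show p = ((ℓ + 1 : ℕ) : ℝ) by push_cast; linarith, Complex.ofReal_natCast,
      Complex.cpow_natCast]
    have hI1 : Complex.I ^ (ℓ + 1) ≠ 0 := pow_ne_zero _ Complex.I_ne_zero
    generalize (∫ ω, (X ω : ℂ) ^ ℓ * Complex.exp (u * X ω * Complex.I) *
      ((∫ t in Ioi 0, cosKernel lam (X ω) t : ℝ) : ℂ) ∂μ) = A
    generalize (∫ ω, (X ω : ℂ) ^ (ℓ + 1) * Complex.exp (u * X ω * Complex.I) ∂μ) = B
    push_cast
    field_simp
    ring
  · simp only [add_zero]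
    rw [integral_const_mul]
    generalize (∫ ω, (X ω : ℂ) ^ ℓ * Complex.exp (u * X ω * Complex.I) *
      ((∫ t in Ioi 0, cosKernel lam (X ω) t : ℝ) : ℂ) ∂μ) = A
    push_cast
    field_simp
    ring
end

section
/- (Zolotarev's formula.) Let p > 0 be a real number that is not an even integer, write m := ⌊p/2⌋ and q := p − 2m ∈ (0,2), and let X be a real random variable with E|X|^p < ∞ and characteristic function f. Then E|X|^p = 2·(−1)^{m+1}·(Γ(q+1)/π)·sin(πq/2) · ∫_0^∞ ( Re f^{(2m)}(t) − Re f^{(2m)}(0) )/t^{q+1} dt, where f^{(2m)} is the 2m-th derivative of f and the integral exists in the Lebesgue sense. -/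
open MeasureTheory Filter Set Topology

theorem integrable_and_integral_swap_of_nonneg {α β : Type*} [MeasurableSpace α]
    [MeasurableSpace β] {μ : Measure α} {ν : Measure β} [SFinite μ] [SFinite ν] {F : α → β → ℝ}
    (hF : Measurable (Function.uncurry F)) (hF0 : ∀ᵐ x ∂μ, ∀ᵐ y ∂ν, 0 ≤ F x y)
    (hFi : ∀ᵐ x ∂μ, Integrable (F x) ν) (hFii : Integrable (fun x => ∫ y, F x y ∂ν) μ) :
    Integrable (fun y => ∫ x, F x y ∂μ) ν ∧ ∫ y, ∫ x, F x y ∂μ ∂ν = ∫ x, ∫ y, F x y ∂ν ∂μ := by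
  have h : Integrable (Function.uncurry F) (μ.prod ν) := by
    refine (integrable_prod_iff hF.aestronglyMeasurable).2 ⟨hFi, hFii.congr ?_⟩
    filter_upwards [hF0] with x hx
    refine integral_congr_ae ?_
    filter_upwards [hx] with y hy
    exact (Real.norm_of_nonneg hy).symm
  exact ⟨h.integral_prod_right, (integral_integral_swap h).symm⟩

theorem integral_rpow_sub_one_div_one_add_sq {q : ℝ} (hq0 : 0 < q) (hq2 : q < 2) :
    IntegrableOn (fun s : ℝ => s ^ (q - 1) / (1 + s ^ 2)) (Ioi 0) ∧
    ∫ s in Ioi (0 : ℝ), s ^ (q - 1) / (1 + s ^ 2)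
      = Real.pi / (2 * Real.sin (Real.pi * q / 2)) := by
  have hinner : ∀ r ∈ Ioi (0 : ℝ),
      ∫ s in Ioi (0 : ℝ), Real.exp (-r) * (s ^ (q - 1) * Real.exp (-r * s ^ (2 : ℝ)))
        = Real.Gamma (q / 2) / 2 * (Real.exp (-r) * r ^ ((1 - q / 2) - 1)) := by
    intro r hr
    rw [integral_const_mul, integral_rpow_mul_exp_neg_mul_rpow two_pos (by linarith) hr,
      show -(q - 1 + 1) / 2 = 1 - q / 2 - 1 by ring, show (q - 1 + 1) / 2 = q / 2 by ring]
    ring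
  have hconv := Real.GammaIntegral_convergent (s := 1 - q / 2) (by linarith)
  obtain ⟨hi, he⟩ := integrable_and_integral_swap_of_nonneg (μ := volume.restrict (Ioi (0 : ℝ)))
    (ν := volume.restrict (Ioi (0 : ℝ)))
    (F := fun r s => Real.exp (-r) * (s ^ (q - 1) * Real.exp (-r * s ^ (2 : ℝ))))
    (by unfold Function.uncurry; fun_prop)
    (by
      filter_upwards with r
      filter_upwards [ae_restrict_mem measurableSet_Ioi] with s (hs : 0 < s)
      positivity)
    (by
      filter_upwards [ae_restrict_mem measurableSet_Ioi] with r hr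
      exact (integrableOn_rpow_mul_exp_neg_mul_rpow (by linarith) two_pos hr).const_mul _)
    (IntegrableOn.congr_fun (hconv.const_mul _) (fun r hr => (hinner r hr).symm)
      measurableSet_Ioi)
  have houter : ∀ s ∈ Ioi (0 : ℝ),
      ∫ r in Ioi (0 : ℝ), Real.exp (-r) * (s ^ (q - 1) * Real.exp (-r * s ^ (2 : ℝ)))
        = s ^ (q - 1) / (1 + s ^ 2) := by
    intro s hs
    have h : ∀ r : ℝ, Real.exp (-r) * (s ^ (q - 1) * Real.exp (-r * s ^ (2 : ℝ)))
        = s ^ (q - 1) * Real.exp (-(1 + s ^ 2) * r) := by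
      intro r
      rw [mul_left_comm, ← Real.exp_add, Real.rpow_two]
      ring_nf
    simp_rw [h]
    rw [integral_const_mul, integral_exp_mul_Ioi (by nlinarith [sq_nonneg s])]
    rw [mul_zero, Real.exp_zero, neg_div_neg_eq, mul_one_div]
  refine ⟨IntegrableOn.congr_fun hi houter measurableSet_Ioi, ?_⟩
  rw [← setIntegral_congr_fun measurableSet_Ioi houter, he,
    setIntegral_congr_fun measurableSet_Ioi hinner, integral_const_mul,
    ← Real.Gamma_eq_integral (by linarith), div_mul_eq_mul_div, Real.Gamma_mul_Gamma_one_sub,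
    div_div, mul_comm _ (2 : ℝ), mul_div_assoc]

theorem integral_one_sub_cos_mul_exp {s : ℝ} (hs : 0 < s) :
    IntegrableOn (fun t : ℝ => (1 - Real.cos t) * Real.exp (-s * t)) (Ioi 0) ∧
    ∫ t in Ioi (0 : ℝ), (1 - Real.cos t) * Real.exp (-s * t) = 1 / (s * (1 + s ^ 2)) := by
  have ha : (-s + Complex.I : ℂ).re < 0 := by simpa
  have hre : ∀ t : ℝ, RCLike.re (Complex.exp ((-s + Complex.I) * t))
      = Real.cos t * Real.exp (-s * t) := by
    intro t
    simp [Complex.exp_re, mul_comm]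
  have hi1 := integrableOn_exp_mul_Ioi (neg_lt_zero.2 hs) 0
  have hic := integrableOn_exp_mul_complex_Ioi ha 0
  have hi2 : IntegrableOn (fun t : ℝ => Real.cos t * Real.exp (-s * t)) (Ioi 0) := by
    simpa only [hre] using! Integrable.re hic
  have he2 : ∫ t in Ioi (0 : ℝ), Real.cos t * Real.exp (-s * t) = s / (1 + s ^ 2) := by
    simp_rw [← hre]
    rw [integral_re hic, integral_exp_mul_complex_Ioi ha]
    simp [Complex.div_re, Complex.normSq_apply]
    ring
  simp_rw [sub_mul, one_mul]
  refine ⟨hi1.sub hi2, ?_⟩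
  rw [integral_sub hi1 hi2, he2, integral_exp_mul_Ioi (neg_lt_zero.2 hs)]
  simp only [mul_zero, Real.exp_zero]
  field_simp
  ring

theorem integral_one_sub_cos_div_rpow {q : ℝ} (hq0 : 0 < q) (hq2 : q < 2) :
    IntegrableOn (fun t : ℝ => (1 - Real.cos t) / t ^ (q + 1)) (Ioi 0) ∧
    ∫ t in Ioi (0 : ℝ), (1 - Real.cos t) / t ^ (q + 1)
      = Real.pi / (2 * Real.Gamma (q + 1) * Real.sin (Real.pi * q / 2)) := by
  have hΓ : 0 < Real.Gamma (q + 1) := Real.Gamma_pos_of_pos (by linarith)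
  obtain ⟨hbi, hbe⟩ := integral_rpow_sub_one_div_one_add_sq hq0 hq2
  have hinner : ∀ s ∈ Ioi (0 : ℝ),
      ∫ t in Ioi (0 : ℝ), s ^ q * ((1 - Real.cos t) * Real.exp (-s * t))
        = s ^ (q - 1) / (1 + s ^ 2) := by
    intro s (hs : 0 < s)
    rw [integral_const_mul, (integral_one_sub_cos_mul_exp hs).2, Real.rpow_sub_one hs.ne']
    field_simp
  obtain ⟨hi, he⟩ := integrable_and_integral_swap_of_nonneg (μ := volume.restrict (Ioi (0 : ℝ)))
    (ν := volume.restrict (Ioi (0 : ℝ)))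
    (F := fun s t => s ^ q * ((1 - Real.cos t) * Real.exp (-s * t)))
    (by unfold Function.uncurry; fun_prop)
    (by
      filter_upwards [ae_restrict_mem measurableSet_Ioi] with s (hs : 0 < s)
      filter_upwards with t
      have := sub_nonneg.2 (Real.cos_le_one t)
      positivity)
    (by
      filter_upwards [ae_restrict_mem measurableSet_Ioi] with s hs
      exact (integral_one_sub_cos_mul_exp hs).1.const_mul _)
    (IntegrableOn.congr_fun hbi (fun s hs => (hinner s hs).symm) measurableSet_Ioi)
  have houter : ∀ t ∈ Ioi (0 : ℝ),
      ∫ s in Ioi (0 : ℝ), s ^ q * ((1 - Real.cos t) * Real.exp (-s * t))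
        = Real.Gamma (q + 1) * ((1 - Real.cos t) / t ^ (q + 1)) := by
    intro t (ht : 0 < t)
    have h : ∀ s : ℝ, s ^ q * ((1 - Real.cos t) * Real.exp (-s * t))
        = (1 - Real.cos t) * (s ^ (q + 1 - 1) * Real.exp (-(t * s))) := by
      intro s
      rw [add_sub_cancel_right, neg_mul, mul_comm s t]
      ring
    simp_rw [h]
    rw [integral_const_mul, Real.integral_rpow_mul_exp_neg_mul_Ioi (by linarith) ht,
      Real.div_rpow zero_le_one ht.le, Real.one_rpow]
    ring
  have hi' : IntegrableOn (fun t : ℝ => Real.Gamma (q + 1) * ((1 - Real.cos t) / t ^ (q + 1)))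
      (Ioi 0) := IntegrableOn.congr_fun hi houter measurableSet_Ioi
  refine ⟨(integrable_const_mul_iff hΓ.ne'.isUnit _).1 hi', ?_⟩
  rw [setIntegral_congr_fun measurableSet_Ioi houter, integral_const_mul,
    setIntegral_congr_fun measurableSet_Ioi hinner, hbe] at he
  rw [eq_div_of_mul_eq hΓ.ne' ((mul_comm _ _).trans he), div_div]
  ring_nf

theorem integral_one_sub_cos_mul_div_rpow {q : ℝ} (hq0 : 0 < q) (hq2 : q < 2) (x : ℝ) :
    IntegrableOn (fun t : ℝ => (1 - Real.cos (t * x)) / t ^ (q + 1)) (Ioi 0) ∧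
    ∫ t in Ioi (0 : ℝ), (1 - Real.cos (t * x)) / t ^ (q + 1)
      = |x| ^ q * (Real.pi / (2 * Real.Gamma (q + 1) * Real.sin (Real.pi * q / 2))) := by
  obtain rfl | hx := eq_or_ne x 0
  · simp [hq0.ne']
  obtain ⟨hi, he⟩ := integral_one_sub_cos_div_rpow hq0 hq2
  have hx' : 0 < |x| := abs_pos.2 hx
  have h : ∀ t ∈ Ioi (0 : ℝ),
      |x| ^ (q + 1) * ((1 - Real.cos (|x| * t)) / (|x| * t) ^ (q + 1))
        = (1 - Real.cos (t * x)) / t ^ (q + 1) := by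
    intro t (ht : 0 < t)
    have hcos : Real.cos (|x| * t) = Real.cos (t * x) := by
      rw [← Real.cos_abs (t * x), abs_mul, abs_of_pos ht, mul_comm]
    rw [hcos, Real.mul_rpow hx'.le ht.le]
    have := Real.rpow_pos_of_pos hx' (q + 1)
    field_simp
  constructor
  · refine IntegrableOn.congr_fun (Integrable.const_mul ?_ _) h measurableSet_Ioi
    exact (integrableOn_Ioi_comp_mul_left_iff
      (fun t : ℝ => (1 - Real.cos t) / t ^ (q + 1)) 0 hx').2 (by simpa using hi)
  · rw [← setIntegral_congr_fun measurableSet_Ioi h, integral_const_mul,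
      integral_comp_mul_left_Ioi (fun t : ℝ => (1 - Real.cos t) / t ^ (q + 1)) 0 hx', mul_zero,
      he, Real.rpow_add_one hx'.ne', smul_eq_mul]
    field_simp

theorem cf_eq_charFun_map {Ω : Type*} [MeasurableSpace Ω] (μ : Measure Ω) {X : Ω → ℝ}
    (hX : Measurable X) : cf μ X = charFun (μ.map X) := by
  ext t
  rw [charFun_apply_real, integral_map hX.aemeasurable (by fun_prop), cf]
  congr with ω
  ring_nf

theorem re_iteratedDeriv_two_mul_cf {Ω : Type*} [MeasurableSpace Ω] (μ : Measure Ω)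
    [IsProbabilityMeasure μ] {X : Ω → ℝ} (hX : Measurable X) {m : ℕ}
    (hXm : MemLp X ((2 * m : ℕ) : ENNReal) μ) (t : ℝ) :
    (iteratedDeriv (2 * m) (cf μ X) t).re
      = (-1) ^ m * ∫ ω, X ω ^ (2 * m) * Real.cos (t * X ω) ∂μ := by
  have : IsProbabilityMeasure (μ.map X) := Measure.isProbabilityMeasure_map hX.aemeasurable
  have hid : MemLp id ((2 * m : ℕ) : ENNReal) (μ.map X) :=
    (memLp_map_measure_iff aestronglyMeasurable_id hX.aemeasurable).2 hXm
  have hint : Integrable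
      (fun ω => (X ω : ℂ) ^ (2 * m) * Complex.exp (t * X ω * Complex.I)) μ := by
    refine (hXm.integrable_norm_pow').mono' (by fun_prop) (ae_of_all _ fun ω => le_of_eq ?_)
    rw [norm_mul, ← Complex.ofReal_mul, Complex.norm_exp_ofReal_mul_I, mul_one, norm_pow,
      Complex.norm_real]
  have hre : ∀ ω, RCLike.re ((X ω : ℂ) ^ (2 * m) * Complex.exp (t * X ω * Complex.I))
      = X ω ^ (2 * m) * Real.cos (t * X ω) := by
    intro ω
    rw [← Complex.ofReal_pow, ← Complex.ofReal_mul, RCLike.re_to_complex, Complex.re_ofReal_mul,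
      Complex.exp_ofReal_mul_I_re]
  rw [cf_eq_charFun_map μ hX, iteratedDeriv_charFun hid,
    integral_map hX.aemeasurable (by fun_prop), pow_mul, Complex.I_sq,
    show ((-1 : ℂ) ^ m) = (((-1 : ℝ) ^ m : ℝ) : ℂ) by push_cast; rfl, Complex.re_ofReal_mul,
    ← RCLike.re_to_complex, ← integral_re hint]
  simp_rw [hre]

theorem stmt10 {Ω : Type*} [MeasurableSpace Ω] (μ : Measure Ω) [IsProbabilityMeasure μ]
    (p : ℝ) (hp : 0 < p) (hpne : ¬∃ n : ℕ, (2 * n : ℝ) = p)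
    (m : ℕ) (hm : m = ⌊p / 2⌋₊) (q : ℝ) (hq : q = p - 2 * m)
    (X : Ω → ℝ) (hX : Measurable X)
    (hmom : Integrable (fun ω => |X ω| ^ p) μ) :
    IntegrableOn
      (fun t =>
        ((iteratedDeriv (2 * m) (cf μ X) t).re - (iteratedDeriv (2 * m) (cf μ X) 0).re)
          / t ^ (q + 1)) (Ioi 0) volume ∧
    (∫ ω, |X ω| ^ p ∂μ)
      = 2 * (-1 : ℝ) ^ (m + 1) * (Real.Gamma (q + 1) / Real.pi) * Real.sin (Real.pi * q / 2)
        * ∫ t in Ioi (0:ℝ),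
            ((iteratedDeriv (2 * m) (cf μ X) t).re - (iteratedDeriv (2 * m) (cf μ X) 0).re)
              / t ^ (q + 1) := by
  have hfl : (m : ℝ) ≤ p / 2 := hm ▸ Nat.floor_le (by positivity)
  have hlt : p / 2 < m + 1 := hm ▸ Nat.lt_floor_add_one _
  have hne : (2 * m : ℝ) ≠ p := fun h => hpne ⟨m, h⟩
  have hle : (2 * m : ℝ) < p := lt_of_le_of_ne (by linarith) hne
  have hq0 : 0 < q := by linarith
  have hq2 : q < 2 := by linarith
  have hsin : 0 < Real.sin (Real.pi * q / 2) :=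
    Real.sin_pos_of_pos_of_lt_pi (by positivity) (by nlinarith [Real.pi_pos])
  have hΓ : 0 < Real.Gamma (q + 1) := Real.Gamma_pos_of_pos (by linarith)
  set C := Real.pi / (2 * Real.Gamma (q + 1) * Real.sin (Real.pi * q / 2)) with hC
  have hXp : MemLp X (ENNReal.ofReal p) μ := by
    refine (integrable_norm_rpow_iff hX.aestronglyMeasurable (by simpa) (by simp)).1 ?_
    simpa [ENNReal.toReal_ofReal hp.le] using hmom
  have hXm : MemLp X ((2 * m : ℕ) : ENNReal) μ := by
    refine hXp.mono_exponent ?_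
    rw [← ENNReal.ofReal_natCast]
    exact ENNReal.ofReal_le_ofReal (by push_cast; exact hle.le)
  have hpow : Integrable (fun ω => X ω ^ (2 * m)) μ :=
    hXm.integrable_norm_pow'.mono' (by fun_prop) (ae_of_all _ fun ω => (norm_pow _ _).le)
  have hcos : ∀ t : ℝ, Integrable (fun ω => X ω ^ (2 * m) * Real.cos (t * X ω)) μ := by
    intro t
    refine hpow.norm.mono' (by fun_prop) (ae_of_all _ fun ω => ?_)
    rw [norm_mul]
    exact mul_le_of_le_one_right (norm_nonneg _) (Real.abs_cos_le_one _)
  have hinner : ∀ ω, ∫ t in Ioi (0 : ℝ), X ω ^ (2 * m) * ((1 - Real.cos (t * X ω)) / t ^ (q + 1))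
      = |X ω| ^ p * C := by
    intro ω
    rw [integral_const_mul, (integral_one_sub_cos_mul_div_rpow hq0 hq2 (X ω)).2, ← mul_assoc,
      ← (even_two_mul m).pow_abs, ← Real.rpow_natCast, ← Real.rpow_add_of_nonneg (abs_nonneg _)
        (by positivity) hq0.le]
    congr 2
    rw [hq]
    push_cast
    ring
  have hdiff : ∀ t : ℝ,
      ((iteratedDeriv (2 * m) (cf μ X) t).re - (iteratedDeriv (2 * m) (cf μ X) 0).re)
          / t ^ (q + 1)
        = (-1) ^ (m + 1) * ∫ ω, X ω ^ (2 * m) * ((1 - Real.cos (t * X ω)) / t ^ (q + 1)) ∂μ := by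
    intro t
    rw [re_iteratedDeriv_two_mul_cf μ hX hXm, re_iteratedDeriv_two_mul_cf μ hX hXm]
    simp_rw [zero_mul, Real.cos_zero, mul_one, ← mul_div_assoc, mul_sub, mul_one]
    rw [integral_div, integral_sub hpow (hcos t)]
    ring
  obtain ⟨hi, he⟩ := integrable_and_integral_swap_of_nonneg (μ := μ)
    (ν := volume.restrict (Ioi (0 : ℝ)))
    (F := fun ω t => X ω ^ (2 * m) * ((1 - Real.cos (t * X ω)) / t ^ (q + 1)))
    (by unfold Function.uncurry; fun_prop)
    (by
      filter_upwards with ω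
      filter_upwards [ae_restrict_mem measurableSet_Ioi] with t (ht : 0 < t)
      have := sub_nonneg.2 (Real.cos_le_one (t * X ω))
      have := (even_two_mul m).pow_nonneg (X ω)
      positivity)
    (ae_of_all _ fun ω => (integral_one_sub_cos_mul_div_rpow hq0 hq2 (X ω)).1.const_mul _)
    (by simpa only [hinner] using hmom.mul_const C)
  simp_rw [hdiff]
  refine ⟨hi.const_mul _, ?_⟩
  rw [integral_const_mul, he]
  simp_rw [hinner]
  have hsign : ((-1 : ℝ) ^ (m + 1)) * (-1) ^ (m + 1) = 1 := by
    rw [← mul_pow]; simp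
  have hconst : 2 * (Real.Gamma (q + 1) / Real.pi) * Real.sin (Real.pi * q / 2) * C = 1 := by
    have := Real.pi_pos
    rw [hC]
    generalize Real.sin (Real.pi * q / 2) = a at hsin
    field_simp
  rw [integral_mul_const]
  linear_combination (-(∫ ω, |X ω| ^ p ∂μ)) * (hsign + (-1) ^ (m + 1) * (-1) ^ (m + 1) * hconst)
end
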